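/- arXiv:2601.00144 — 11 statements merged into one kernel-verified Lean document; each statement's English description precedes it below -/
import Mathlib

section
/- Let r ≥ 3 and let k be an integer with 0 < k ≤ r!/3. Then: (i) every n-vertex (r,k)-tournament with n ≥ r contains a directed tight path on r vertices; and (ii) for every n ≥ r+1 there exists an n-vertex (r,k)-tournament containing no directed tight path on r+1 vertices. -/
/-- An `(r,k)`-tournament on vertex set `Fin n`: every edge is an injective
`r`-tuple of vertices, and for every `r`-element set of vertices exactly `k`
of its orderings are edges. -/
def IsRKTournament (r k n : ℕ) (E : Set (Fin r → Fin n)) : Prop :=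
  (∀ e ∈ E, Function.Injective e) ∧
  ∀ S : Finset (Fin n), S.card = r →
    {e | e ∈ E ∧ ∀ i, e i ∈ S}.ncard = k

/-- `v` is a directed tight path sequence in the `r`-digraph with edge set `E`:
its entries are distinct and every `r` consecutive entries form an edge. -/
def IsTightPathSeq {r n s : ℕ} (E : Set (Fin r → Fin n)) (v : Fin s → Fin n) : Prop :=
  Function.Injective v ∧
  ∀ j : ℕ, ∀ h : j + r ≤ s,
    (fun i : Fin r => v ⟨j + i.1, by have := i.isLt; omega⟩) ∈ E

/-- The `r`-digraph with edge set `E` contains a directed tight path on `s` vertices. -/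
def HasTightPath (r : ℕ) {n : ℕ} (E : Set (Fin r → Fin n)) (s : ℕ) : Prop :=
  ∃ v : Fin s → Fin n, IsTightPathSeq E v

/-- The injective `r`-tuples with entries in `S`. -/
def tuplesIn (r : ℕ) {n : ℕ} (S : Finset (Fin n)) : Finset (Fin r → Fin n) :=
  {e | Function.Injective e ∧ ∀ i, e i ∈ S}

theorem mem_tuplesIn {r n : ℕ} {S : Finset (Fin n)} {e : Fin r → Fin n} :
    e ∈ tuplesIn r S ↔ Function.Injective e ∧ ∀ i, e i ∈ S := by
  simp [tuplesIn]

theorem factorial_le_card_tuplesIn {r n : ℕ} {S : Finset (Fin n)} (hS : S.card = r) :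
    r.factorial ≤ (tuplesIn r S).card := by
  have hcard : Fintype.card (Fin r ↪ S) = r.factorial := by
    rw [Fintype.card_embedding_eq, Fintype.card_coe, Fintype.card_fin, hS, Nat.descFactorial_self]
  rw [← hcard, ← Finset.card_univ]
  refine Finset.card_le_card_of_injOn (fun f i => (f i : Fin n)) ?_ ?_
  · intro f _
    exact mem_tuplesIn.2 ⟨fun i j h => f.injective (Subtype.ext h), fun i => (f i).2⟩
  · intro f _ g _ h
    ext i
    exact congrArg Fin.val (congrFun h i)

/-- The tuples in `tuplesIn r S` whose entry at `b` exceeds those at `a` and `c`. -/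
def peakTuples {r n : ℕ} (S : Finset (Fin n)) (a b c : Fin r) : Finset (Fin r → Fin n) :=
  {e ∈ tuplesIn r S | e a < e b ∧ e c < e b}

theorem card_peakTuples_perm_le {r n : ℕ} (S : Finset (Fin n)) (a b c : Fin r)
    (σ : Equiv.Perm (Fin r)) :
    (peakTuples S (σ a) (σ b) (σ c)).card ≤ (peakTuples S a b c).card := by
  refine Finset.card_le_card_of_injOn (fun e => e ∘ σ) ?_ ?_
  · intro e he
    simp only [peakTuples, mem_tuplesIn, Finset.coe_filter, Set.mem_ofPred_eq,
      Function.comp_apply] at he ⊢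
    exact ⟨⟨he.1.1.comp σ.injective, fun i => he.1.2 _⟩, he.2⟩
  · exact σ.surjective.injective_comp_right.injOn

theorem factorial_le_three_mul_card_peakTuples {r n : ℕ} {S : Finset (Fin n)} (hS : S.card = r)
    {a b c : Fin r} (hab : a ≠ b) (hac : a ≠ c) (hbc : b ≠ c) :
    r.factorial ≤ 3 * (peakTuples S a b c).card := by
  have hcover : tuplesIn r S ⊆
      peakTuples S a b c ∪ (peakTuples S b a c ∪ peakTuples S a c b) := by
    intro e he
    have hinj := (mem_tuplesIn.1 he).1
    have h1 := hinj.ne hab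
    have h2 := hinj.ne hac
    have h3 := hinj.ne hbc
    simp only [peakTuples, Finset.mem_union, Finset.mem_filter, he, true_and]
    omega
  have h1 := card_peakTuples_perm_le S a b c (Equiv.swap a b)
  have h2 := card_peakTuples_perm_le S a b c (Equiv.swap b c)
  rw [Equiv.swap_apply_left, Equiv.swap_apply_right,
    Equiv.swap_apply_of_ne_of_ne hac.symm hbc.symm] at h1
  rw [Equiv.swap_apply_left, Equiv.swap_apply_right, Equiv.swap_apply_of_ne_of_ne hab hac] at h2
  have h3 := factorial_le_card_tuplesIn hS
  have h4 := Finset.card_le_card hcover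
  have h5 := Finset.card_union_le (peakTuples S a b c) (peakTuples S b a c ∪ peakTuples S a c b)
  have h6 := Finset.card_union_le (peakTuples S b a c) (peakTuples S a c b)
  omega

theorem IsRKTournament.hasTightPath {r k n : ℕ} {E : Set (Fin r → Fin n)}
    (hE : IsRKTournament r k n E) (hk : 0 < k) (hn : r ≤ n) : HasTightPath r E r := by
  obtain ⟨S, -, hS⟩ := Finset.exists_subset_card_eq
    (s := (Finset.univ : Finset (Fin n))) (n := r) (by simpa using hn)
  have hpos := hE.2 S hS ▸ hk
  obtain ⟨e, he, -⟩ := Set.nonempty_of_ncard_ne_zero hpos.ne'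
  refine ⟨e, hE.1 e he, fun j h => ?_⟩
  obtain rfl : j = 0 := by omega
  simpa using he

/-- Prescribing `k` orderings of every `r`-set yields an `(r,k)`-tournament. -/
theorem exists_isRKTournament_of_forall_le_card {r k n : ℕ} (P : Set (Fin r → Fin n))
    (F : Finset (Fin n) → Finset (Fin r → Fin n))
    (hF : ∀ S, F S ⊆ tuplesIn r S) (hFP : ∀ S, ∀ e ∈ F S, e ∈ P)
    (hcard : ∀ S : Finset (Fin n), S.card = r → k ≤ (F S).card) :
    ∃ E ⊆ P, IsRKTournament r k n E := by
  choose! G hGF hGk using fun S hS => Finset.exists_subset_card_eq (hcard S hS)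
  refine ⟨{e | Function.Injective e ∧ e ∈ G (Finset.univ.image e)}, ?_, fun e he => he.1, ?_⟩
  · rintro e ⟨hinj, he⟩
    refine hFP _ _ (hGF (Finset.univ.image e) ?_ he)
    simp [Finset.card_image_of_injective _ hinj]
  · intro S hS
    have himage {e : Fin r → Fin n} (hinj : Function.Injective e) (heS : ∀ i, e i ∈ S) :
        Finset.univ.image e = S := by
      refine Finset.eq_of_subset_of_card_le (by simpa [Finset.image_subset_iff] using heS) ?_
      simp [Finset.card_image_of_injective _ hinj, hS]
    rw [← hGk S hS, ← Set.ncard_coe_finset]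
    congr 1
    ext e
    constructor
    · rintro ⟨⟨hinj, he⟩, heS⟩
      rwa [himage hinj heS] at he
    · intro he
      obtain ⟨hinj, heS⟩ := mem_tuplesIn.1 (hF S (hGF S hS he))
      refine ⟨⟨hinj, ?_⟩, heS⟩
      rwa [himage hinj heS]

theorem not_hasTightPath_of_forall_peak {r n : ℕ} (hr : 3 ≤ r) {E : Set (Fin r → Fin n)}
    (hE : ∀ e ∈ E, e ⟨0, by omega⟩ < e ⟨1, by omega⟩ ∧ e ⟨2, by omega⟩ < e ⟨1, by omega⟩) :
    ¬ HasTightPath r E (r + 1) := by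
  rintro ⟨v, -, hv⟩
  have h0 := (hE _ (hv 0 (by omega))).2
  have h1 := (hE _ (hv 1 (by omega))).1
  exact lt_asymm h0 h1

/-- Proposition: if `r ≥ 3` and `0 < k ≤ r!/3`, then (i) every `n`-vertex
`(r,k)`-tournament with `n ≥ r` contains a tight path on `r` vertices, and
(ii) for every `n ≥ r+1` there is an `n`-vertex `(r,k)`-tournament with no
tight path on `r+1` vertices. -/
theorem stmt0 (r k : ℕ) (hr : 3 ≤ r) (hk : 0 < k) (hk3 : 3 * k ≤ r.factorial) :
    (∀ n : ℕ, r ≤ n → ∀ E : Set (Fin r → Fin n),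
      IsRKTournament r k n E → HasTightPath r E r) ∧
    (∀ n : ℕ, r + 1 ≤ n → ∃ E : Set (Fin r → Fin n),
      IsRKTournament r k n E ∧ ¬ HasTightPath r E (r + 1)) := by
  refine ⟨fun n hn E hE => hE.hasTightPath hk hn, fun n _ => ?_⟩
  let a : Fin r := ⟨0, by omega⟩
  let b : Fin r := ⟨1, by omega⟩
  let c : Fin r := ⟨2, by omega⟩
  obtain ⟨E, hEP, hE⟩ := exists_isRKTournament_of_forall_le_card (k := k)
    {e : Fin r → Fin n | e a < e b ∧ e c < e b} (fun S => peakTuples S a b c)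
    (fun S => Finset.filter_subset _ _) (fun S e he => (Finset.mem_filter.1 he).2)
    (fun S hS => by
      have := factorial_le_three_mul_card_peakTuples hS
        (show a ≠ b by simp [a, b]) (show a ≠ c by simp [a, c]) (show b ≠ c by simp [b, c])
      omega)
  exact ⟨E, hE, not_hasTightPath_of_forall_peak hr hEP⟩
end

section
/- Let r ≥ 1 and t ≥ 1. Then: (i) for k = W_t(PSG_r) and every n, there exists an n-vertex (r,k)-tournament containing no directed tight path on r−1+t vertices; and (ii) for k = 1 + W_t(PSG_r), there exists n_0 such that for all n ≥ n_0, every n-vertex (r,k)-tournament contains a directed tight path on r−1+t vertices. In other words, the minimum k such that every sufficiently large (r,k)-tournament contains a tight path of length t is exactly 1 + W_t(PSG_r). -/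
/-- The adjacency relation of the pattern-shift graph `PSG_r`: permutations of
`Fin r` (written as the tuple of their values), with an edge from `a` to `b`
iff the `(r-1)`-suffix of `a` pattern-matches the `(r-1)`-prefix of `b`. -/
def PSGAdj (r : ℕ) (a b : Equiv.Perm (Fin r)) : Prop :=
  ∀ i j : ℕ, ∀ hi : i + 1 < r, ∀ hj : j + 1 < r,
    (a ⟨i + 1, hi⟩ < a ⟨j + 1, hj⟩ ↔
      b ⟨i, Nat.lt_of_succ_lt hi⟩ < b ⟨j, Nat.lt_of_succ_lt hj⟩)

/-- `w` is a walk (of size `t`) in the digraph with adjacency `Adj`. -/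
def IsWalk {V : Type*} {t : ℕ} (Adj : V → V → Prop) (w : Fin t → V) : Prop :=
  ∀ i : ℕ, ∀ h : i + 1 < t, Adj (w ⟨i, Nat.lt_of_succ_lt h⟩) (w ⟨i + 1, h⟩)

/-- `W_t(G)`: the maximum size of a vertex set whose induced subgraph has no
walk of size `t`. -/
noncomputable def walkFreeMax {V : Type*} [Fintype V] (Adj : V → V → Prop) (t : ℕ) : ℕ :=
  sSup {m | ∃ S : Finset V, S.card = m ∧
    ¬ ∃ w : Fin t → V, (∀ i, w i ∈ S) ∧ IsWalk Adj w}

/-- `τ_t(G)`: the minimum size of a vertex set intersecting every walk of size `t`. -/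
noncomputable def walkTransMin {V : Type*} [Fintype V] (Adj : V → V → Prop) (t : ℕ) : ℕ :=
  sInf {m | ∃ S : Finset V, S.card = m ∧
    ∀ w : Fin t → V, IsWalk Adj w → ∃ i, w i ∈ S}

section Ramsey

/-- If large sets contain large homogeneous subsets for colourings of `r`-sets, then they contain
large subsets on which the colour of an `(r+1)`-set depends only on its minimum. -/
theorem exists_subset_color_determined_by_min {C : Type} [Nonempty C] (r : ℕ)
    (ramsey : ∀ m : ℕ, ∃ N : ℕ, ∀ (α : Type) [LinearOrder α] (X : Finset α) (c : Finset α → C),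
      N ≤ X.card → ∃ T ⊆ X, T.card = m ∧ ∃ k, ∀ S ⊆ T, S.card = r → c S = k) (L : ℕ) :
    ∃ N : ℕ, ∀ (α : Type) [LinearOrder α] (X : Finset α) (c : Finset α → C), N ≤ X.card →
      ∃ Y ⊆ X, Y.card = L ∧ ∃ g : α → C, ∀ x ∈ Y, ∀ S ⊆ Y, (∀ y ∈ S, x < y) → S.card = r →
        c (insert x S) = g x := by
  induction L with
  | zero =>
    refine ⟨0, fun α _ X c _ => ⟨∅, by simp, by simp, fun _ => Classical.arbitrary C, by simp⟩⟩
  | succ L ih =>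
    obtain ⟨M, hM⟩ := ih
    obtain ⟨N, hN⟩ := ramsey M
    refine ⟨N + 1, fun α _ X c hX => ?_⟩
    have hne : X.Nonempty := Finset.card_pos.mp (by omega)
    set x := X.min' hne
    have hxX : x ∈ X := X.min'_mem hne
    obtain ⟨Z, hZX, hZ, k, hk⟩ := hN α (X.erase x) (fun S => c (insert x S))
      (by rw [Finset.card_erase_of_mem hxX]; omega)
    obtain ⟨Y, hYZ, hY, g, hg⟩ := hM α Z c hZ.ge
    have hlt : ∀ y ∈ Y, x < y := fun y hy => by
      have h := hZX (hYZ hy)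
      rw [Finset.mem_erase] at h
      exact lt_of_le_of_ne (X.min'_le y h.2) (Ne.symm h.1)
    have hxY : x ∉ Y := fun h => lt_irrefl _ (hlt x h)
    refine ⟨insert x Y, Finset.insert_subset hxX fun y hy =>
      Finset.mem_of_mem_erase (hZX (hYZ hy)), by rw [Finset.card_insert_of_notMem hxY, hY],
      Function.update g x k, fun z hz S hS hlS hcS => ?_⟩
    have hSY : S ⊆ Y := fun y hy => by
      rcases Finset.mem_insert.mp (hS hy) with rfl | h
      · rcases Finset.mem_insert.mp hz with h | h
        · exact absurd (hlS _ hy) (by rw [h]; exact lt_irrefl _)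
        · exact absurd (hlS _ hy) (hlt z h).asymm
      · exact h
    rcases Finset.mem_insert.mp hz with rfl | h
    · rw [Function.update_self]
      exact hk S (hSY.trans hYZ) hcS
    · rw [Function.update_of_ne (fun h' => hxY (by rwa [← h']))]
      exact hg z h S hSY hlS hcS

/-- Ramsey's theorem for colourings of `r`-sets with finitely many colours. -/
theorem exists_homogeneous_subset {C : Type} [Nonempty C] [Fintype C] (r m : ℕ) :
    ∃ N : ℕ, ∀ (α : Type) [LinearOrder α] (X : Finset α) (c : Finset α → C),
      N ≤ X.card → ∃ T ⊆ X, T.card = m ∧ ∃ k, ∀ S ⊆ T, S.card = r → c S = k := by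
  classical
  induction r generalizing m with
  | zero =>
    refine ⟨m, fun α _ X c hX => ?_⟩
    obtain ⟨T, hT, hc⟩ := Finset.exists_subset_card_eq hX
    exact ⟨T, hT, hc, c ∅, fun S _ hS => by rw [Finset.card_eq_zero.mp hS]⟩
  | succ r ih =>
    obtain ⟨N, hN⟩ := exists_subset_color_determined_by_min r ih (Fintype.card C * m)
    refine ⟨N, fun α _ X c hX => ?_⟩
    obtain ⟨Y, hYX, hY, g, hg⟩ := hN α X c hX
    obtain ⟨k, -, hk⟩ := Finset.exists_le_card_fiber_of_mul_le_card_of_maps_to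
      (s := Y) (t := Finset.univ) (f := g) (n := m) (fun _ _ => Finset.mem_univ _)
      Finset.univ_nonempty (by rw [hY, Finset.card_univ])
    obtain ⟨T, hT, hc⟩ := Finset.exists_subset_card_eq hk
    refine ⟨T, fun x hx => hYX (Finset.mem_filter.mp (hT hx)).1, hc, k, fun S hS hSc => ?_⟩
    have hne : S.Nonempty := Finset.card_pos.mp (by omega)
    have hmin : S.min' hne ∈ S := S.min'_mem hne
    have hSY : S ⊆ Y := fun y hy => (Finset.mem_filter.mp (hT (hS hy))).1
    have h := hg _ (hSY hmin) (S.erase (S.min' hne)) ((Finset.erase_subset _ _).trans hSY)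
      (fun y hy => S.min'_lt_of_mem_erase_min' hne hy)
      (by rw [Finset.card_erase_of_mem hmin]; omega)
    rw [Finset.insert_erase hmin] at h
    rw [h]
    exact (Finset.mem_filter.mp (hT (hS hmin))).2

end Ramsey

section Patterns

/-- Permutations that compare their entries in the same way are equal. -/
theorem Equiv.Perm.eq_of_lt_iff_lt {r : ℕ} {σ τ : Equiv.Perm (Fin r)}
    (h : ∀ i j, σ i < σ j ↔ τ i < τ j) : σ = τ := by
  have hmono : StrictMono (τ ∘ σ.symm) := fun i j hij => by
    simpa using (h (σ.symm i) (σ.symm j)).mp (by simpa using hij)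
  have heq : τ ∘ σ.symm = id := (hmono.range_inj strictMono_id).mp
    (by rw [Set.range_id]; exact (σ.symm.trans τ).surjective.range_eq)
  ext i
  have := congrFun heq (σ i)
  simp at this
  rw [this]

/-- An injective tuple with entries in a set `S` of the same size is the increasing enumeration
of `S` precomposed with a permutation, the pattern of the tuple. -/
theorem exists_perm_eq_orderEmbOfFin_comp {α : Type*} [LinearOrder α] {r : ℕ} {S : Finset α}
    (hS : S.card = r) {e : Fin r → α} (he : Function.Injective e) (heS : ∀ i, e i ∈ S) :
    ∃ σ : Equiv.Perm (Fin r), e = S.orderEmbOfFin hS ∘ σ := by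
  have hinj : Function.Injective fun i => (S.orderIsoOfFin hS).symm ⟨e i, heS i⟩ :=
    fun i j hij => he (congrArg Subtype.val ((S.orderIsoOfFin hS).symm.injective hij))
  refine ⟨Equiv.ofBijective _ (Finite.injective_iff_bijective.mp hinj), ?_⟩
  funext i
  simp [← Finset.coe_orderIsoOfFin_apply]

/-- The patterns of the edges spanned by `S` in the `r`-digraph with edge set `E`. -/
def edgePatterns {α : Type*} [LinearOrder α] {r : ℕ} (E : Set (Fin r → α)) (S : Finset α) :
    Set (Equiv.Perm (Fin r)) :=
  {σ | ∃ hS : S.card = r, S.orderEmbOfFin hS ∘ σ ∈ E}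

/-- Edges spanned by `S` are in bijection with their patterns. -/
theorem ncard_edgePatterns {α : Type*} [LinearOrder α] {r : ℕ} {E : Set (Fin r → α)}
    (hE : ∀ e ∈ E, Function.Injective e) {S : Finset α} (hS : S.card = r) :
    (edgePatterns E S).ncard = {e | e ∈ E ∧ ∀ i, e i ∈ S}.ncard := by
  have himage : {e | e ∈ E ∧ ∀ i, e i ∈ S} =
      (fun σ : Equiv.Perm (Fin r) => S.orderEmbOfFin hS ∘ σ) '' edgePatterns E S := by
    ext e
    constructor
    · rintro ⟨he, heS⟩
      obtain ⟨σ, rfl⟩ := exists_perm_eq_orderEmbOfFin_comp hS (hE e he) heS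
      exact ⟨σ, ⟨hS, he⟩, rfl⟩
    · rintro ⟨σ, ⟨_, hσ⟩, rfl⟩
      exact ⟨hσ, fun i => S.orderEmbOfFin_mem hS _⟩
  rw [himage, Set.ncard_image_of_injective]
  intro σ τ h
  refine Equiv.ext fun i => ?_
  simpa using congrFun h i

/-- The pattern of an injective tuple occurs among the edge patterns iff the tuple is an edge. -/
theorem mem_edgePatterns_image_iff {α : Type*} [LinearOrder α] {r : ℕ} {E : Set (Fin r → α)}
    {e : Fin r → α} (he : Function.Injective e) {σ : Equiv.Perm (Fin r)}
    (hσ : ∀ i j, e i < e j ↔ σ i < σ j) :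
    σ ∈ edgePatterns E (Finset.univ.image e) ↔ e ∈ E := by
  have hS : (Finset.univ.image e).card = r := by
    rw [Finset.card_image_of_injective _ he, Finset.card_fin]
  obtain ⟨τ, hτ⟩ := exists_perm_eq_orderEmbOfFin_comp hS he (fun i => by simp)
  obtain rfl : σ = τ := Equiv.Perm.eq_of_lt_iff_lt fun i j => by
    rw [← hσ]
    conv_lhs => rw [hτ]
    simp
  constructor
  · rintro ⟨_, h⟩
    rwa [hτ]
  · intro h
    exact ⟨hS, hτ ▸ h⟩

/-- A gap between two finite sets contains a point outside any given finite set. -/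
theorem exists_between_finsets_notMem {α : Type*} [LinearOrder α] [DenselyOrdered α]
    [NoMinOrder α] [NoMaxOrder α] [Nonempty α] {A B : Finset α}
    (hAB : ∀ a ∈ A, ∀ b ∈ B, a < b) (F : Finset α) :
    ∃ x, (∀ a ∈ A, a < x) ∧ (∀ b ∈ B, x < b) ∧ x ∉ F := by
  obtain ⟨y, hA, hB⟩ := Order.exists_between_finsets A B hAB
  obtain ⟨x, hlo, hhi⟩ := Order.exists_between_finsets
    ((A ∪ F).filter (· ≤ y)) ((B ∪ F).filter (y < ·)) fun a ha b hb =>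
      (Finset.mem_filter.mp ha).2.trans_lt (Finset.mem_filter.mp hb).2
  refine ⟨x, fun a ha => hlo a ?_, fun b hb => hhi b ?_, fun hx => ?_⟩
  · simp [ha, (hA a ha).le]
  · simp [hb, hB b hb]
  · rcases le_or_gt x y with h | h
    · exact lt_irrefl _ (hlo x (by simp [hx, h]))
    · exact lt_irrefl _ (hhi x (by simp [hx, h]))

/-- Every walk in the pattern-shift graph is the sequence of patterns of the windows of some
sequence of distinct rationals. -/
theorem exists_seq_of_pattern_walk (d t : ℕ) (w : ℕ → Equiv.Perm (Fin (d + 1)))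
    (hw : ∀ j < t, PSGAdj (d + 1) (w j) (w (j + 1))) :
    ∃ u : ℕ → ℚ, Set.InjOn u (Set.Iic (d + t)) ∧
      ∀ j ≤ t, ∀ i i' : Fin (d + 1), u (j + i) < u (j + i') ↔ w j i < w j i' := by
  induction t with
  | zero =>
    refine ⟨fun i => if h : i < d + 1 then ((w 0 ⟨i, h⟩ : ℕ) : ℚ) else 0, ?_, ?_⟩
    · intro i hi j hj hij
      simp only [add_zero, Set.mem_Iic] at hi hj
      simp only [Nat.lt_succ_of_le hi, Nat.lt_succ_of_le hj, dif_pos, Nat.cast_inj] at hij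
      exact congrArg Fin.val ((w 0).injective (Fin.ext hij))
    · intro j hj i i'
      obtain rfl : j = 0 := by omega
      simp [Fin.is_le]
  | succ t ih =>
    obtain ⟨u, hinj, hu⟩ := ih fun j hj => hw j (by omega)
    have hadj : ∀ i i' : ℕ, ∀ (hi : i < d) (hi' : i' < d),
        u (t + 1 + i) < u (t + 1 + i') ↔
          w (t + 1) ⟨i, by omega⟩ < w (t + 1) ⟨i', by omega⟩ := fun i i' hi hi' => by
      have h := hu t le_rfl ⟨i + 1, by omega⟩ ⟨i' + 1, by omega⟩
      have h' := hw t (by omega) i i' (by omega) (by omega)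
      rw [← h', ← h]
      simp only [add_assoc, add_comm 1]
    let val : Fin d → ℚ := fun i => u (t + 1 + i)
    obtain ⟨x, hA, hB, hF⟩ := exists_between_finsets_notMem
      (A := (Finset.univ.filter fun i : Fin d =>
        w (t + 1) i.castSucc < w (t + 1) (Fin.last d)).image val)
      (B := (Finset.univ.filter fun i : Fin d =>
        w (t + 1) (Fin.last d) < w (t + 1) i.castSucc).image val)
      (by
        simp only [Finset.mem_image, Finset.mem_filter, Finset.mem_univ, true_and]
        rintro _ ⟨i, hi, rfl⟩ _ ⟨i', hi', rfl⟩
        exact (hadj i i' i.2 i'.2).mpr (hi.trans hi'))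
      ((Finset.range (d + t + 1)).image u)
    simp only [Finset.mem_image, Finset.mem_filter, Finset.mem_univ, true_and,
      forall_exists_index, and_imp, forall_apply_eq_imp_iff₂, Finset.mem_range, not_exists,
      not_and] at hA hB hF
    have hold : ∀ i, i ≤ d + t → Function.update u (d + t + 1) x i = u i := fun i hi =>
      Function.update_of_ne (by omega) _ _
    have hnew : Function.update u (d + t + 1) x (d + t + 1) = x := Function.update_self _ _ _
    have hlt : ∀ i : Fin d, u (t + 1 + i) < x ↔
        w (t + 1) i.castSucc < w (t + 1) (Fin.last d) := fun i => by
      refine ⟨fun h => ?_, hA i⟩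
      by_contra h'
      have hne : w (t + 1) (Fin.last d) ≠ w (t + 1) i.castSucc := fun h'' =>
        (Fin.castSucc_lt_last i).ne' ((w (t + 1)).injective h'')
      exact lt_asymm h (hB i (lt_of_le_of_ne (not_lt.mp h') hne))
    have hgt : ∀ i : Fin d, x < u (t + 1 + i) ↔
        w (t + 1) (Fin.last d) < w (t + 1) i.castSucc := fun i => by
      refine ⟨fun h => ?_, hB i⟩
      by_contra h'
      have hne : w (t + 1) i.castSucc ≠ w (t + 1) (Fin.last d) := fun h'' =>
        (Fin.castSucc_lt_last i).ne ((w (t + 1)).injective h'')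
      exact lt_asymm h (hA i (lt_of_le_of_ne (not_lt.mp h') hne))
    refine ⟨Function.update u (d + t + 1) x, ?_, ?_⟩
    · intro i hi j hj hij
      simp only [Set.mem_Iic, ← add_assoc] at hi hj
      rcases Nat.lt_or_ge i (d + t + 1) with h1 | h1 <;>
        rcases Nat.lt_or_ge j (d + t + 1) with h2 | h2
      · rw [hold i (by omega), hold j (by omega)] at hij
        exact hinj (Set.mem_Iic.mpr (by omega)) (Set.mem_Iic.mpr (by omega)) hij
      · obtain rfl : j = d + t + 1 := by omega
        rw [hold i (by omega), hnew] at hij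
        exact absurd hij (hF i h1)
      · obtain rfl : i = d + t + 1 := by omega
        rw [hold j (by omega), hnew] at hij
        exact absurd hij.symm (hF j h2)
      · omega
    · intro j hj i i'
      rcases Nat.lt_or_ge j (t + 1) with h | h
      · rw [hold _ (by omega), hold _ (by omega)]
        exact hu j (by omega) i i'
      · obtain rfl : j = t + 1 := by omega
        have hlast : t + 1 + d = d + t + 1 := by omega
        induction i using Fin.lastCases with
        | last =>
          induction i' using Fin.lastCases with
          | last => simp
          | cast i' =>
            rw [Fin.val_last, Fin.val_castSucc, hlast, hnew, hold _ (by omega)]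
            exact hgt i'
        | cast i =>
          induction i' using Fin.lastCases with
          | last =>
            rw [Fin.val_last, Fin.val_castSucc, hlast, hnew, hold _ (by omega)]
            exact hlt i
          | cast i' =>
            rw [Fin.val_castSucc, Fin.val_castSucc, hold _ (by omega), hold _ (by omega)]
            exact hadj i i' i.2 i'.2

end Patterns

section WalkFree

variable {V : Type*} [Fintype V] {Adj : V → V → Prop} {t : ℕ}

theorem bddAbove_card_walkFree (Adj : V → V → Prop) (t : ℕ) :
    BddAbove {m | ∃ S : Finset V, S.card = m ∧
      ¬ ∃ w : Fin t → V, (∀ i, w i ∈ S) ∧ IsWalk Adj w} :=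
  ⟨Fintype.card V, by rintro _ ⟨S, rfl, -⟩; exact S.card_le_univ⟩

theorem exists_card_eq_walkFreeMax (Adj : V → V → Prop) (ht : 1 ≤ t) :
    ∃ S : Finset V, S.card = walkFreeMax Adj t ∧
      ¬ ∃ w : Fin t → V, (∀ i, w i ∈ S) ∧ IsWalk Adj w :=
  Nat.sSup_mem (s := {m | ∃ S : Finset V, S.card = m ∧
    ¬ ∃ w : Fin t → V, (∀ i, w i ∈ S) ∧ IsWalk Adj w})
    ⟨0, ∅, rfl, fun ⟨_, hw, _⟩ => Finset.notMem_empty _ (hw ⟨0, ht⟩)⟩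
    (bddAbove_card_walkFree Adj t)

theorem exists_walk_of_walkFreeMax_lt_card {S : Finset V} (hS : walkFreeMax Adj t < S.card) :
    ∃ w : Fin t → V, (∀ i, w i ∈ S) ∧ IsWalk Adj w := by
  by_contra h
  exact absurd (le_csSup (bddAbove_card_walkFree Adj t) ⟨S, rfl, h⟩) hS.not_ge

end WalkFree

/-- The `r`-digraph of all tuples with pattern in a set without walks of size `t` has no tight
path on `r - 1 + t` vertices. -/
theorem exists_tournament_without_tightPath (r t n : ℕ) (P : Finset (Equiv.Perm (Fin r)))
    (hP : ¬ ∃ w : Fin t → Equiv.Perm (Fin r), (∀ i, w i ∈ P) ∧ IsWalk (PSGAdj r) w) :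
    ∃ E : Set (Fin r → Fin n), IsRKTournament r P.card n E ∧ ¬ HasTightPath r E (r - 1 + t) := by
  set E : Set (Fin r → Fin n) :=
    {e | Function.Injective e ∧ ∃ σ ∈ P, ∀ i j, e i < e j ↔ σ i < σ j}
  refine ⟨E, ⟨fun e he => he.1, fun S hS => ?_⟩, ?_⟩
  · rw [← ncard_edgePatterns (fun e he => he.1) hS, ← Set.ncard_coe_finset]
    congr 1
    ext σ
    constructor
    · rintro ⟨_, -, τ, hτ, h⟩
      obtain rfl : σ = τ := Equiv.Perm.eq_of_lt_iff_lt fun i j => by simpa using h i j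
      exact hτ
    · intro hσ
      exact ⟨hS, (S.orderEmbOfFin hS).injective.comp σ.injective, σ, hσ, fun i j => by simp⟩
  · rintro ⟨v, -, hv⟩
    have hwin : ∀ j : Fin t, ∃ σ ∈ P, ∀ i i' : Fin r,
        v ⟨j + i.1, by omega⟩ < v ⟨j + i'.1, by omega⟩ ↔ σ i < σ i' :=
      fun j => by
        rcases Nat.eq_zero_or_pos r with rfl | hr
        · obtain ⟨-, σ, hσ, -⟩ := hv 0 (by omega)
          exact ⟨σ, hσ, fun i => i.elim0⟩
        · exact (hv j (by omega)).2
    choose w hwP hw using hwin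
    refine hP ⟨w, hwP, fun j hj i i' hi hi' => ?_⟩
    rw [← hw, ← hw]
    simp only [add_assoc, add_comm 1]

/-- A set whose `r`-subsets all have the same edge patterns contains every tight path described
by a walk through these patterns. -/
theorem hasTightPath_of_homogeneous {d t n : ℕ} {E : Set (Fin (d + 1) → Fin n)}
    {T : Finset (Fin n)} (hT : T.card = d + (t + 1)) {K : Set (Equiv.Perm (Fin (d + 1)))}
    (hK : ∀ S ⊆ T, S.card = d + 1 → edgePatterns E S = K)
    {w : Fin (t + 1) → Equiv.Perm (Fin (d + 1))} (hwK : ∀ i, w i ∈ K)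
    (hw : IsWalk (PSGAdj (d + 1)) w) : HasTightPath (d + 1) E (d + (t + 1)) := by
  obtain ⟨u, hinj, hu⟩ := exists_seq_of_pattern_walk d t
    (fun j => w ⟨min j t, by omega⟩) fun j hj => by
      have h := hw j (by omega)
      simpa only [min_eq_left hj.le, min_eq_left (Nat.succ_le_of_lt hj)] using h
  have huinj : Function.Injective fun i : Fin (d + (t + 1)) => u i := fun i j hij =>
    Fin.ext (hinj (Set.mem_Iic.mpr (by omega)) (Set.mem_Iic.mpr (by omega)) hij)
  obtain ⟨σ, hσ⟩ := exists_perm_eq_orderEmbOfFin_comp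
    (S := Finset.univ.image fun i : Fin (d + (t + 1)) => u i)
    (by rw [Finset.card_image_of_injective _ huinj, Finset.card_fin]) huinj (fun i => by simp)
  have hσlt : ∀ i j : Fin (d + (t + 1)), σ i < σ j ↔ u i < u j := fun i j => by
    rw [show u i = _ from congrFun hσ i, show u j = _ from congrFun hσ j]
    simp
  have hvinj : Function.Injective (T.orderEmbOfFin hT ∘ σ) :=
    (T.orderEmbOfFin hT).injective.comp σ.injective
  refine ⟨T.orderEmbOfFin hT ∘ σ, hvinj, fun j hj => ?_⟩
  have he : Function.Injective fun i : Fin (d + 1) =>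
      (T.orderEmbOfFin hT ∘ σ) ⟨j + i.1, by omega⟩ := fun i i' h => by
    have := hvinj h
    simp only [Fin.mk.injEq] at this
    exact Fin.ext (by omega)
  refine (mem_edgePatterns_image_iff (σ := w ⟨j, by omega⟩) he fun i i' => ?_).mp ?_
  · have h := hu j (by omega) i i'
    simp only [min_eq_left (show j ≤ t by omega)] at h
    rw [← h]
    simpa using hσlt ⟨j + i, by omega⟩ ⟨j + i', by omega⟩
  · rw [hK]
    · exact hwK _
    · intro x hx
      obtain ⟨i, -, rfl⟩ := Finset.mem_image.mp hx
      exact T.orderEmbOfFin_mem hT _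
    · rw [Finset.card_image_of_injective _ he, Finset.card_fin]

/-- Theorem: the threshold for tight paths on `r-1+t` vertices in
`(r,k)`-tournaments is exactly `1 + W_t(PSG_r)`. -/
theorem stmt1 (r t : ℕ) (hr : 1 ≤ r) (ht : 1 ≤ t) :
    (∀ n : ℕ, ∃ E : Set (Fin r → Fin n),
      IsRKTournament r (walkFreeMax (PSGAdj r) t) n E ∧
      ¬ HasTightPath r E (r - 1 + t)) ∧
    (∃ n₀ : ℕ, ∀ n : ℕ, n₀ ≤ n → ∀ E : Set (Fin r → Fin n),
      IsRKTournament r (1 + walkFreeMax (PSGAdj r) t) n E →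
      HasTightPath r E (r - 1 + t)) := by
  refine ⟨fun n => ?_, ?_⟩
  · obtain ⟨P, hPcard, hP⟩ := exists_card_eq_walkFreeMax (PSGAdj r) ht
    rw [← hPcard]
    exact exists_tournament_without_tightPath r t n P hP
  · obtain ⟨d, rfl⟩ := Nat.exists_eq_add_of_le' hr
    obtain ⟨t, rfl⟩ := Nat.exists_eq_add_of_le' ht
    obtain ⟨N, hN⟩ := exists_homogeneous_subset (C := Set (Equiv.Perm (Fin (d + 1)))) (d + 1)
      (d + (t + 1))
    refine ⟨N, fun n hn E hE => ?_⟩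
    obtain ⟨T, -, hT, K, hK⟩ := hN (Fin n) Finset.univ (edgePatterns E)
      (by rwa [Finset.card_fin])
    obtain ⟨S, hST, hS⟩ := Finset.exists_subset_card_eq (show d + 1 ≤ T.card by omega)
    have hcard : K.ncard = 1 + walkFreeMax (PSGAdj (d + 1)) (t + 1) := by
      rw [← hK S hST hS, ncard_edgePatterns hE.1 hS, hE.2 S hS]
    obtain ⟨w, hwK, hw⟩ := exists_walk_of_walkFreeMax_lt_card (Adj := PSGAdj (d + 1))
      (t := t + 1) (S := K.toFinite.toFinset)
      (by rw [← Set.ncard_eq_toFinset_card]; omega)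
    exact hasTightPath_of_homogeneous hT hK (fun i => by simpa using hwK i) hw
end

section
/- For all integers r ≥ 1 and t ≥ 1, τ_t(PSG_r) ≤ (1/r + ⌈(r−1)/t⌉·(1/r))·r!, i.e., τ_t(PSG_r) ≤ (1 + ⌈(r−1)/t⌉)·(r−1)!. -/
/-- Along an edge of the pattern-shift graph, the position of the minimum moves one step to the
left, unless it is at the first position before or at the last position after. -/
lemma PSGAdj.symm_zero_succ {n : ℕ} {a b : Equiv.Perm (Fin (n + 1))} (h : PSGAdj (n + 1) a b)
    (ha : (a.symm 0 : ℕ) ≠ 0) (hb : (b.symm 0 : ℕ) ≠ n) :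
    (b.symm 0 : ℕ) + 1 = a.symm 0 := by
  have hp := (a.symm 0).isLt
  have hq := (b.symm 0).isLt
  by_contra hne
  have hlt : a.symm 0 ≠ ⟨(b.symm 0 : ℕ) + 1, by omega⟩ := fun h' =>
    hne (congrArg Fin.val h').symm
  have key := h (a.symm 0 - 1) (b.symm 0) (by omega) (by omega)
  have e : (⟨(a.symm 0 : ℕ) - 1 + 1, by omega⟩ : Fin (n + 1)) = a.symm 0 :=
    Fin.ext (Nat.sub_add_cancel (by omega))
  rw [e, Equiv.apply_symm_apply, Fin.eta, Equiv.apply_symm_apply] at key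
  refine absurd (key.1 (Fin.pos_iff_ne_zero.2 fun h0 => hlt ?_)) (Fin.not_lt_zero _)
  exact a.symm_apply_eq.2 h0.symm

/-- The number of permutations whose minimum is at a position in `P`. -/
lemma card_filter_symm_zero_mem {n : ℕ} (P : Finset (Fin (n + 1))) :
    (Finset.univ.filter fun a : Equiv.Perm (Fin (n + 1)) => a.symm 0 ∈ P).card =
      P.card * n.factorial := by
  have h : (P ×ˢ (Finset.univ : Finset (Equiv.Perm (Fin n)))).card = P.card * n.factorial := by
    rw [Finset.card_product, Finset.card_univ, Fintype.card_perm, Fintype.card_fin]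
  rw [← h]
  refine Finset.card_bij' (fun a _ => Equiv.Perm.decomposeFin a.symm)
    (fun x _ => (Equiv.Perm.decomposeFin.symm x).symm) ?_ ?_ ?_ ?_
  · intro a ha
    have e : (Equiv.Perm.decomposeFin a.symm).1 = a.symm 0 := by
      conv_rhs => rw [← Equiv.Perm.decomposeFin.symm_apply_apply a.symm]
      exact (Equiv.Perm.decomposeFin_symm_apply_zero _ _).symm
    simpa [e] using ha
  · rintro ⟨p, e⟩ hx
    simpa using hx
  · intro a _
    simp
  · intro x _
    simp

/-- At most `1 + ⌈n / t⌉` elements of `{0, …, n}` are equal to `n` or divisible by `t`. -/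
lemma card_filter_eq_or_dvd_le (n : ℕ) {t : ℕ} (ht : 1 ≤ t) :
    (Finset.univ.filter fun p : Fin (n + 1) => (p : ℕ) = n ∨ t ∣ p).card ≤
      1 + (n + (t - 1)) / t := by
  rw [← Finset.card_image_of_injective _ Fin.val_injective]
  have hsub : (Finset.univ.filter fun p : Fin (n + 1) => (p : ℕ) = n ∨ t ∣ p).image Fin.val ⊆
      insert n ((Finset.range ((n + (t - 1)) / t)).image (· * t)) := by
    intro x hx
    obtain ⟨p, hp, rfl⟩ := Finset.mem_image.1 hx
    have hlt := p.isLt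
    by_cases hn : (p : ℕ) = n
    · exact Finset.mem_insert.2 (Or.inl hn)
    obtain ⟨k, hk⟩ := ((Finset.mem_filter.1 hp).2).resolve_left hn
    refine Finset.mem_insert_of_mem (Finset.mem_image.2 ⟨k, ?_, by rw [hk, mul_comm]⟩)
    rw [Finset.mem_range, Nat.lt_iff_add_one_le, Nat.le_div_iff_mul_le ht]
    have : (k + 1) * t = t * k + t := by ring
    omega
  calc _ ≤ _ := Finset.card_le_card hsub
    _ ≤ _ := Finset.card_insert_le _ _
    _ ≤ (n + (t - 1)) / t + 1 := by
      gcongr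
      exact Finset.card_image_le.trans (Finset.card_range _).le
    _ = _ := add_comm _ _

/-- Every walk of size `t` in the pattern-shift graph meets a permutation whose minimum is at the
last position or at a (zero-based) position divisible by `t`. -/
lemma IsWalk.exists_symm_zero_eq_or_dvd {n t : ℕ} (ht : 1 ≤ t)
    {w : Fin t → Equiv.Perm (Fin (n + 1))} (hw : IsWalk (PSGAdj (n + 1)) w) :
    ∃ i, ((w i).symm 0 : ℕ) = n ∨ t ∣ ((w i).symm 0 : ℕ) := by
  by_contra! H
  have key : ∀ i (hi : i < t), ((w ⟨i, hi⟩).symm 0 : ℕ) + i = (w ⟨0, ht⟩).symm 0 := by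
    intro i
    induction i with
    | zero => intro _; rfl
    | succ i ih =>
      intro hi
      have h0 : ((w ⟨i, Nat.lt_of_succ_lt hi⟩).symm 0 : ℕ) ≠ 0 := fun h =>
        (H ⟨i, Nat.lt_of_succ_lt hi⟩).2 (by rw [h]; exact dvd_zero t)
      have := (hw i hi).symm_zero_succ h0 (H _).1
      have := ih (Nat.lt_of_succ_lt hi)
      omega
  have hm := key _ (Nat.mod_lt ((w ⟨0, ht⟩).symm 0 : ℕ) ht)
  refine (H ⟨_, Nat.mod_lt ((w ⟨0, ht⟩).symm 0 : ℕ) ht⟩).2 ?_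
  rw [Nat.eq_sub_of_add_eq hm]
  exact Nat.dvd_sub_mod _

/-- Proposition: `τ_t(PSG_r) ≤ (1 + ⌈(r−1)/t⌉)·(r−1)!`. -/
theorem stmt2 (r t : ℕ) (hr : 1 ≤ r) (ht : 1 ≤ t) :
    walkTransMin (PSGAdj r) t ≤ (1 + (r - 1 + (t - 1)) / t) * (r - 1).factorial := by
  obtain ⟨n, rfl⟩ := Nat.exists_eq_add_of_le' hr
  rw [Nat.add_sub_cancel]
  refine le_trans (Nat.sInf_le ⟨_, card_filter_symm_zero_mem
    (Finset.univ.filter fun p : Fin (n + 1) => (p : ℕ) = n ∨ t ∣ p), fun w hw => ?_⟩)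
    (Nat.mul_le_mul_right _ (card_filter_eq_or_dvd_le n ht))
  obtain ⟨i, hi⟩ := hw.exists_symm_zero_eq_or_dvd ht
  exact ⟨i, by simpa using hi⟩
end

section
/- For all integers r and t with 1 ≤ t ≤ r, τ_t(PSG_r) ≥ ⌈r/t⌉·(r−1)!. -/
open Finset in
/-- A set of residues meeting every window of `t` consecutive residues modulo `n + 1`
has size at least `(n + 1) / t`. -/
theorem card_le_mul_card_of_forall_window {n t : ℕ} (A : Finset (Fin (n + 1)))
    (hA : ∀ x : Fin (n + 1), ∃ k < t, x + Fin.ofNat (n + 1) k ∈ A) :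
    n + 1 ≤ t * #A := by
  have hcover : (univ : Finset (Fin (n + 1))) ⊆
      (range t).biUnion fun k ↦ A.image (· - Fin.ofNat (n + 1) k) := by
    intro x _
    obtain ⟨k, hk, hx⟩ := hA x
    exact mem_biUnion.2 ⟨k, mem_range.2 hk, mem_image.2 ⟨_, hx, add_sub_cancel_right _ _⟩⟩
  calc n + 1 = #(univ : Finset (Fin (n + 1))) := by simp
    _ ≤ _ := card_le_card hcover
    _ ≤ #(range t) * #A := card_biUnion_le_card_mul _ _ _ fun k _ ↦ card_image_le
    _ = t * #A := by rw [card_range]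

/-- Rotating a permutation cyclically by one step follows an edge of the pattern-shift graph. -/
theorem psgAdj_addRight_trans {n : ℕ} (b : Equiv.Perm (Fin (n + 1))) (x : Fin (n + 1)) :
    PSGAdj (n + 1) ((Equiv.addRight x).trans b) ((Equiv.addRight (x + 1)).trans b) := by
  have key : ∀ i : ℕ, ∀ hi : i + 1 < n + 1,
      (⟨i + 1, hi⟩ : Fin (n + 1)) + x = ⟨i, Nat.lt_of_succ_lt hi⟩ + (x + 1) := by
    intro i hi
    have h : (⟨i + 1, hi⟩ : Fin (n + 1)) = ⟨i, Nat.lt_of_succ_lt hi⟩ + 1 := by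
      ext
      simp [Fin.val_add, Nat.mod_eq_of_lt hi]
    rw [h, add_assoc, add_comm 1 x]
  intro i j hi hj
  simp only [Equiv.trans_apply, Equiv.coe_addRight, key]

open Finset in
/-- If every permutation has at least `m` cyclic rotations in `S`, then `S` has at least
`m * n !` elements. -/
theorem mul_factorial_le_card_of_forall_rotations {n m : ℕ}
    (S : Finset (Equiv.Perm (Fin (n + 1))))
    (hS : ∀ b : Equiv.Perm (Fin (n + 1)), m ≤ #{x | (Equiv.addRight x).trans b ∈ S}) :
    m * n.factorial ≤ #S := by
  have hrot : ∀ x : Fin (n + 1),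
      #{b : Equiv.Perm (Fin (n + 1)) | (Equiv.addRight x).trans b ∈ S} ≤ #S := fun x ↦
    card_le_card_of_injOn (fun b ↦ (Equiv.addRight x).trans b) (by intro b; simp) fun b _ c _ h ↦
      mul_right_cancel (a := b) (b := Equiv.addRight x) (c := c) h
  refine Nat.le_of_mul_le_mul_left (c := n + 1) ?_ n.succ_pos
  calc (n + 1) * (m * n.factorial)
      = ∑ _b : Equiv.Perm (Fin (n + 1)), m := by
        simp [Fintype.card_perm, Nat.factorial_succ]; ring
    _ ≤ ∑ b : Equiv.Perm (Fin (n + 1)), #{x | (Equiv.addRight x).trans b ∈ S} :=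
        sum_le_sum fun b _ ↦ hS b
    _ = ∑ x : Fin (n + 1), #{b : Equiv.Perm (Fin (n + 1)) | (Equiv.addRight x).trans b ∈ S} :=
        sum_card_bipartiteAbove_eq_sum_card_bipartiteBelow
          (fun (b : Equiv.Perm (Fin (n + 1))) x ↦ (Equiv.addRight x).trans b ∈ S)
    _ ≤ ∑ _x : Fin (n + 1), #S := sum_le_sum fun x _ ↦ hrot x
    _ = (n + 1) * #S := by simp

/-- Proposition: if `1 ≤ t ≤ r`, then `τ_t(PSG_r) ≥ ⌈r/t⌉·(r−1)!`. -/
theorem stmt3 (r t : ℕ) (ht : 1 ≤ t) (htr : t ≤ r) :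
    ((r + (t - 1)) / t) * (r - 1).factorial ≤ walkTransMin (PSGAdj r) t := by
  obtain ⟨n, rfl⟩ : ∃ n, r = n + 1 := ⟨r - 1, by omega⟩
  refine le_csInf ⟨_, Finset.univ, rfl, fun w _ ↦ ⟨⟨0, ht⟩, Finset.mem_univ _⟩⟩ ?_
  rintro _ ⟨S, rfl, hS⟩
  refine mul_factorial_le_card_of_forall_rotations S fun b ↦ ?_
  have hwindow := card_le_mul_card_of_forall_window (t := t)
    (Finset.univ.filter fun x : Fin (n + 1) ↦ (Equiv.addRight x).trans b ∈ S) fun x ↦ by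
      obtain ⟨k, hk⟩ := hS (fun k ↦ (Equiv.addRight (x + Fin.ofNat (n + 1) k)).trans b)
        fun i hi ↦ by
          have h : Fin.ofNat (n + 1) (i + 1) = Fin.ofNat (n + 1) i + 1 := by
            ext
            simp [Fin.val_add]
          simpa only [h, add_assoc] using psgAdj_addRight_trans b (x + Fin.ofNat (n + 1) i)
      exact ⟨k, k.isLt, by simpa using hk⟩
  refine Nat.le_of_lt_succ ((Nat.div_lt_iff_lt_mul ht).2 ?_)
  rw [Nat.succ_mul, mul_comm _ t]
  omega
end

section
/- Let r ≥ 2 and let t ≥ 1 be an integer dividing r−1. Then τ_t(PSG_r) = (1/r + 1/t − 1/(tr))·r! and W_t(PSG_r) = (1 − 1/r − 1/t + 1/(tr))·r!. -/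
/-- The rotation `j ↦ a (j + i)` of the list `a`. -/
def rotatePerm {n : ℕ} (a : Equiv.Perm (Fin (n + 1))) (i : Fin (n + 1)) :
    Equiv.Perm (Fin (n + 1)) :=
  (Equiv.addRight i).trans a

theorem rotatePerm_apply {n : ℕ} (a : Equiv.Perm (Fin (n + 1))) (i j : Fin (n + 1)) :
    rotatePerm a i j = a (j + i) := rfl

theorem rotatePerm_symm_apply {n : ℕ} (a : Equiv.Perm (Fin (n + 1))) (i x : Fin (n + 1)) :
    (rotatePerm a i).symm x = a.symm x - i := by
  rw [Equiv.symm_apply_eq, rotatePerm_apply, sub_add_cancel, Equiv.apply_symm_apply]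

theorem psgAdj_rotatePerm {n : ℕ} (a : Equiv.Perm (Fin (n + 1))) (i : Fin (n + 1)) :
    PSGAdj (n + 1) (rotatePerm a i) (rotatePerm a (i + 1)) := by
  intro x y hx hy
  have key : ∀ (z : ℕ) (hz : z + 1 < n + 1),
      (⟨z + 1, hz⟩ : Fin (n + 1)) + i = ⟨z, Nat.lt_of_succ_lt hz⟩ + (i + 1) := by
    intro z hz
    have : (⟨z + 1, hz⟩ : Fin (n + 1)) = ⟨z, Nat.lt_of_succ_lt hz⟩ + 1 := by
      apply Fin.ext
      rw [Fin.val_add_one_of_lt]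
      simpa [Fin.lt_def] using hz
    rw [this, add_assoc, add_comm 1 i]
  simp only [rotatePerm_apply, key]

theorem rotatePerm_bijective {n : ℕ} (i : Fin (n + 1)) :
    Function.Bijective fun a : Equiv.Perm (Fin (n + 1)) => rotatePerm a i := by
  rw [← Finite.injective_iff_bijective]
  intro a b h
  ext j
  have := congrArg (fun e : Equiv.Perm (Fin (n + 1)) => e (j - i)) h
  simpa [rotatePerm_apply] using congrArg Fin.val this

/-- Counting membership of rotations in two ways. -/
theorem sum_card_rotatePerm_mem {n : ℕ} (S : Finset (Equiv.Perm (Fin (n + 1)))) :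
    ∑ a : Equiv.Perm (Fin (n + 1)), (Finset.univ.filter fun i => rotatePerm a i ∈ S).card =
      (n + 1) * S.card := by
  simp only [Finset.card_filter]
  rw [Finset.sum_comm]
  have h : ∀ i : Fin (n + 1),
      ∑ a : Equiv.Perm (Fin (n + 1)), (if rotatePerm a i ∈ S then 1 else 0) = S.card := by
    intro i
    rw [(rotatePerm_bijective i).sum_comp (fun b => if b ∈ S then 1 else 0)]
    simp
  simp [h]

/-- A subset of a cyclic group meeting every window of `t` consecutive elements
has at least a `1 / t` fraction of the elements. -/
theorem card_le_mul_card_filter {n t : ℕ} (P : Fin (n + 1) → Prop) [DecidablePred P]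
    (h : ∀ i, ∃ j : Fin t, P (i + (j : ℕ) • 1)) :
    n + 1 ≤ t * (Finset.univ.filter P).card := by
  have h1 : ∀ j : Fin t,
      ∑ i : Fin (n + 1), (if P (i + (j : ℕ) • (1 : Fin (n + 1))) then 1 else 0) =
        (Finset.univ.filter P).card := by
    intro j
    rw [Finset.card_filter]
    exact Equiv.sum_comp (Equiv.addRight ((j : ℕ) • (1 : Fin (n + 1))))
      (fun i => if P i then 1 else 0)
  calc n + 1 = ∑ _i : Fin (n + 1), 1 := by simp
    _ ≤ ∑ i : Fin (n + 1), ∑ j : Fin t, (if P (i + (j : ℕ) • (1 : Fin (n + 1))) then 1 else 0) := by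
        refine Finset.sum_le_sum fun i _ => ?_
        obtain ⟨j, hj⟩ := h i
        calc 1 = if P (i + (j : ℕ) • (1 : Fin (n + 1))) then 1 else 0 := by simp [hj]
          _ ≤ _ := Finset.single_le_sum
            (f := fun j : Fin t => if P (i + (j : ℕ) • (1 : Fin (n + 1))) then 1 else 0)
            (fun _ _ => Nat.zero_le _) (Finset.mem_univ j)
    _ = t * (Finset.univ.filter P).card := by
        rw [Finset.sum_comm]
        simp [h1]

theorem transversal_card_ge {q t : ℕ} (S : Finset (Equiv.Perm (Fin (t * q + 1))))
    (hS : ∀ w : Fin t → Equiv.Perm (Fin (t * q + 1)), IsWalk (PSGAdj (t * q + 1)) w →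
      ∃ i, w i ∈ S) :
    (q + 1) * (t * q).factorial ≤ S.card := by
  have hcycle : ∀ a : Equiv.Perm (Fin (t * q + 1)),
      q + 1 ≤ (Finset.univ.filter fun i => rotatePerm a i ∈ S).card := by
    intro a
    have hle := card_le_mul_card_filter (t := t) (fun i => rotatePerm a i ∈ S) fun i => by
      refine hS (fun j => rotatePerm a (i + (j : ℕ) • 1)) fun k hk => ?_
      have := psgAdj_rotatePerm a (i + k • 1)
      rwa [add_assoc, ← succ_nsmul] at this
    by_contra! hlt
    have := Nat.mul_le_mul_left t (Nat.le_of_lt_succ hlt)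
    omega
  have hsum := Finset.sum_le_sum fun a (_ : a ∈ Finset.univ) => hcycle a
  rw [sum_card_rotatePerm_mem, Finset.sum_const, Finset.card_univ, Fintype.card_perm,
    Fintype.card_fin, smul_eq_mul, Nat.factorial_succ] at hsum
  refine Nat.le_of_mul_le_mul_left ?_ (Nat.succ_pos (t * q))
  linarith

/-- The permutations whose maximal entry sits at a position divisible by `t`
(counting positions from `0`). -/
def maxPosDvd (n t : ℕ) : Finset (Equiv.Perm (Fin (n + 1))) :=
  Finset.univ.filter fun a => t ∣ (a.symm (Fin.last n) : ℕ)

theorem card_fin_dvd {q t : ℕ} (ht : 1 ≤ t) :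
    (Finset.univ.filter fun k : Fin (t * q + 1) => t ∣ (k : ℕ)).card = q + 1 := by
  rw [← Finset.card_range (q + 1)]
  symm
  refine Finset.card_bij
    (fun k hk => (⟨t * k, Nat.lt_succ_of_le (Nat.mul_le_mul_left t
      (Nat.le_of_lt_succ (Finset.mem_range.1 hk)))⟩ : Fin (t * q + 1))) ?_ ?_ ?_
  · intro k hk
    simp
  · intro k _ l _ h
    exact Nat.eq_of_mul_eq_mul_left ht (Fin.mk.inj_iff.1 h)
  · rintro ⟨_, hk⟩ hb
    obtain ⟨k, rfl⟩ := (Finset.mem_filter.1 hb).2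
    refine ⟨k, ?_, rfl⟩
    exact Finset.mem_range.2 (Nat.lt_succ_of_le
      (Nat.le_of_mul_le_mul_left (Nat.le_of_lt_succ hk) ht))

theorem card_maxPosDvd {q t : ℕ} (ht : 1 ≤ t) :
    (maxPosDvd (t * q) t).card = (q + 1) * (t * q).factorial := by
  have hcycle : ∀ a : Equiv.Perm (Fin (t * q + 1)),
      (Finset.univ.filter fun i => rotatePerm a i ∈ maxPosDvd (t * q) t).card = q + 1 := by
    intro a
    rw [← card_fin_dvd (q := q) ht, Finset.card_filter, Finset.card_filter,
      ← (Equiv.subLeft (a.symm (Fin.last (t * q)))).sum_comp]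
    refine Finset.sum_congr rfl fun i _ => ?_
    simp [maxPosDvd, rotatePerm_symm_apply]
  have hsum := sum_card_rotatePerm_mem (maxPosDvd (t * q) t)
  simp only [hcycle] at hsum
  rw [Finset.sum_const, Finset.card_univ, Fintype.card_perm,
    Fintype.card_fin, smul_eq_mul, Nat.factorial_succ] at hsum
  refine Nat.eq_of_mul_eq_mul_left (Nat.succ_pos (t * q)) ?_
  linarith

/-- Along an edge, the maximum moves one position to the left, unless it is
shifted out or the new last entry becomes the maximum. -/
theorem PSGAdj.maxPos_succ {n : ℕ} {a b : Equiv.Perm (Fin (n + 1))} (h : PSGAdj (n + 1) a b)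
    (ha : (a.symm (Fin.last n) : ℕ) ≠ 0) (hb : (b.symm (Fin.last n) : ℕ) ≠ n) :
    (b.symm (Fin.last n) : ℕ) + 1 = a.symm (Fin.last n) := by
  obtain ⟨m, hm⟩ := Nat.exists_eq_succ_of_ne_zero ha
  have hmlt := (a.symm (Fin.last n)).isLt
  have hplt := (b.symm (Fin.last n)).isLt
  by_contra hne
  have hp1 : (b.symm (Fin.last n) : ℕ) + 1 < n + 1 := by omega
  have hm1 : m + 1 < n + 1 := by omega
  have hlast : (⟨m + 1, hm1⟩ : Fin (n + 1)) = a.symm (Fin.last n) := Fin.ext hm.symm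
  have hlt := (h _ m hp1 hm1).1 (by
    rw [hlast, Equiv.apply_symm_apply]
    refine lt_of_le_of_ne (Fin.le_last _) fun heq => hne ?_
    exact (congrArg Fin.val ((Equiv.symm_apply_eq a).2 heq.symm)).symm)
  rw [Fin.eta, Equiv.apply_symm_apply] at hlt
  exact absurd hlt (not_lt.2 (Fin.le_last _))

theorem maxPosDvd_transversal {q t : ℕ} (ht : 1 ≤ t)
    (w : Fin t → Equiv.Perm (Fin (t * q + 1))) (hw : IsWalk (PSGAdj (t * q + 1)) w) :
    ∃ i, w i ∈ maxPosDvd (t * q) t := by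
  by_contra! hnot
  simp only [maxPosDvd, Finset.mem_filter, Finset.mem_univ, true_and] at hnot
  have hpos : ∀ (k : ℕ) (hk : k < t), ((w ⟨k, hk⟩).symm (Fin.last (t * q)) : ℕ) + k =
      (w ⟨0, ht⟩).symm (Fin.last (t * q)) := by
    intro k
    induction k with
    | zero => intro _; rfl
    | succ k ih =>
      intro hk
      have hstep := (hw k hk).maxPos_succ
        (fun h0 => hnot _ (h0 ▸ dvd_zero t)) (fun hn => hnot _ (hn ▸ dvd_mul_right t q))
      have := ih (Nat.lt_of_succ_lt hk)
      omega
  have hmod := Nat.mod_lt ((w ⟨0, ht⟩).symm (Fin.last (t * q)) : ℕ) ht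
  apply hnot ⟨_, hmod⟩
  rw [Nat.eq_sub_of_add_eq (hpos _ hmod)]
  exact Nat.dvd_sub_mod _

theorem isLeast_transversal {q t : ℕ} (ht : 1 ≤ t) :
    IsLeast {m | ∃ S : Finset (Equiv.Perm (Fin (t * q + 1))), S.card = m ∧
      ∀ w : Fin t → Equiv.Perm (Fin (t * q + 1)), IsWalk (PSGAdj (t * q + 1)) w →
        ∃ i, w i ∈ S} ((q + 1) * (t * q).factorial) := by
  refine ⟨⟨_, card_maxPosDvd ht, maxPosDvd_transversal ht⟩, ?_⟩
  rintro _ ⟨S, rfl, hS⟩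
  exact transversal_card_ge S hS

/-- Complementation exchanges transversals of the walks and walk-free sets. -/
theorem walkFreeMax_add_of_isLeast {V : Type*} [Fintype V] [DecidableEq V] {Adj : V → V → Prop}
    {t m : ℕ} (h : IsLeast {m | ∃ S : Finset V, S.card = m ∧
      ∀ w : Fin t → V, IsWalk Adj w → ∃ i, w i ∈ S} m) :
    walkFreeMax Adj t + m = Fintype.card V := by
  obtain ⟨⟨S, hSm, hS⟩, hmin⟩ := h
  have hg : IsGreatest {m | ∃ S : Finset V, S.card = m ∧
      ¬ ∃ w : Fin t → V, (∀ i, w i ∈ S) ∧ IsWalk Adj w} Sᶜ.card := by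
    refine ⟨⟨Sᶜ, rfl, ?_⟩, ?_⟩
    · rintro ⟨w, hmem, hw⟩
      obtain ⟨i, hi⟩ := hS w hw
      exact Finset.mem_compl.1 (hmem i) hi
    · rintro _ ⟨T, rfl, hT⟩
      have hle : m ≤ Tᶜ.card := hmin ⟨Tᶜ, rfl, fun w hw => by
        by_contra! hno
        exact hT ⟨w, fun i => by simpa using hno i, hw⟩⟩
      have h1 := Finset.card_add_card_compl S
      have h2 := Finset.card_add_card_compl T
      omega
  rw [walkFreeMax, hg.csSup_eq, ← hSm, add_comm]
  exact Finset.card_add_card_compl S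

/-- Theorem: if `t` divides `r−1`, then
`τ_t(PSG_r) = (1/r + 1/t − 1/(tr))·r!` and
`W_t(PSG_r) = (1 − 1/r − 1/t + 1/(tr))·r!`. -/
theorem stmt4 (r t : ℕ) (hr : 2 ≤ r) (ht : 1 ≤ t) (hdvd : t ∣ (r - 1)) :
    (walkTransMin (PSGAdj r) t : ℚ) =
      (1 / (r : ℚ) + 1 / (t : ℚ) - 1 / ((t : ℚ) * (r : ℚ))) * r.factorial ∧
    (walkFreeMax (PSGAdj r) t : ℚ) =
      (1 - 1 / (r : ℚ) - 1 / (t : ℚ) + 1 / ((t : ℚ) * (r : ℚ))) * r.factorial := by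
  obtain ⟨q, hq⟩ := hdvd
  obtain rfl : r = t * q + 1 := by omega
  have hleast := isLeast_transversal (q := q) ht
  have hτ : walkTransMin (PSGAdj (t * q + 1)) t = (q + 1) * (t * q).factorial :=
    hleast.csInf_eq
  have hW := walkFreeMax_add_of_isLeast hleast
  rw [Fintype.card_perm, Fintype.card_fin] at hW
  have hWQ : (walkFreeMax (PSGAdj (t * q + 1)) t : ℚ) + (q + 1) * (t * q).factorial =
      (t * q + 1).factorial := by exact_mod_cast hW
  have ht0 : (t : ℚ) ≠ 0 := by positivity
  have hr0 : (t : ℚ) * q + 1 ≠ 0 := by positivity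
  have hmain : ((q : ℚ) + 1) * (t * q).factorial =
      (1 / ((t * q + 1 : ℕ) : ℚ) + 1 / (t : ℚ) - 1 / ((t : ℚ) * ((t * q + 1 : ℕ) : ℚ))) *
        (t * q + 1).factorial := by
    rw [Nat.factorial_succ]
    push_cast
    field_simp
    ring
  refine ⟨?_, ?_⟩
  · rw [hτ, ← hmain]
    push_cast
    ring
  · linear_combination hWQ - hmain
end

section
/- Let uv be an edge of PSG_r with u = (u_1,...,u_r) and v = (v_1,...,v_r), let i be the index with u_i = r, and let j be the index with v_j = r. Then j = i−1, or j = r, or i = 1. Consequently, every cycle in PSG_r contains a vertex (u_1,...,u_r) with u_1 = r or u_r = r. -/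
/-- Along an edge of `PSG_r`, the position of the largest value moves one step to the left,
unless it is first in the source or last in the target. -/
theorem PSGAdj.position_max {r : ℕ} {u v : Equiv.Perm (Fin r)} (h : PSGAdj r u v)
    {i j m : Fin r} (hm : ∀ x, x ≤ m) (hi : u i = m) (hj : v j = m) :
    j.1 + 1 = i.1 ∨ j.1 = r - 1 ∨ i.1 = 0 := by
  by_contra! hne
  obtain ⟨hji, hjr, hi0⟩ := hne
  obtain ⟨i, hir⟩ := i
  obtain ⟨j, hjlt⟩ := j
  obtain ⟨k, rfl⟩ := Nat.exists_eq_succ_of_ne_zero hi0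
  have hjs : j + 1 < r := by
    have : j ≠ r - 1 := hjr
    omega
  have hlt : u ⟨j + 1, hjs⟩ < u ⟨k + 1, hir⟩ := by
    refine lt_of_le_of_ne ((hm _).trans_eq hi.symm) fun heq => hji ?_
    exact congrArg Fin.val (u.injective heq)
  have hlt' := (h j k hjs hir).1 hlt
  rw [hj] at hlt'
  exact (hm _).not_gt hlt'

/-- Proposition: if `uv` is an edge of `PSG_r`, `u_i = r` and `v_j = r`
(positions written `0`-indexed, so `u i = r-1`-th value means largest), then
`j = i - 1`, or `j` is the last position, or `i` is the first position.
Consequently, every cycle of `PSG_r` contains a vertex with the largest value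
in the first or the last position. -/
theorem stmt6 (r : ℕ) (hr : 1 ≤ r) :
    (∀ u v : Equiv.Perm (Fin r), PSGAdj r u v →
      ∀ i j : Fin r, u i = ⟨r - 1, by omega⟩ → v j = ⟨r - 1, by omega⟩ →
        j.1 + 1 = i.1 ∨ j.1 = r - 1 ∨ i.1 = 0) ∧
    (∀ (t : ℕ) (ht : 0 < t) (w : Fin t → Equiv.Perm (Fin r)),
      Function.Injective w →
      (∀ i : Fin t, PSGAdj r (w i) (w ⟨(i.1 + 1) % t, Nat.mod_lt _ ht⟩)) →
      ∃ i : Fin t, w i ⟨0, by omega⟩ = ⟨r - 1, by omega⟩ ∨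
        w i ⟨r - 1, by omega⟩ = ⟨r - 1, by omega⟩) := by
  have hmax : ∀ x : Fin r, x ≤ ⟨r - 1, by omega⟩ := fun x => Nat.le_sub_one_of_lt x.isLt
  refine ⟨fun u v h i j hi hj => h.position_max hmax hi hj, fun t ht w _ hw => ?_⟩
  have : Nonempty (Fin t) := ⟨⟨0, ht⟩⟩
  obtain ⟨i, hmin⟩ := Finite.exists_min fun i => (w i).symm ⟨r - 1, by omega⟩
  have hle := Fin.le_def.1 (hmin ⟨(i.1 + 1) % t, Nat.mod_lt _ ht⟩)
  rcases (hw i).position_max hmax ((w i).apply_symm_apply _) (Equiv.apply_symm_apply _ _) with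
    h | h | h
  · omega
  · exact ⟨_, Or.inr ((Equiv.eq_symm_apply _).1 (Fin.ext h.symm))⟩
  · exact ⟨i, Or.inl ((Equiv.eq_symm_apply _).1 (Fin.ext h.symm))⟩
end

section
/- Let t ≥ 1 and let r ≥ max{3t+2, 3}. Then τ(PSG_r) ≤ r!·(1/r + 1/(r·t!) + 6(3t+2)/(r(r−1))). -/
/-- `a(G)`: the maximum size of a vertex set inducing an acyclic subgraph
(no cycles; a loop is a cycle of size 1). -/
noncomputable def acyclicMax {V : Type*} [Fintype V] (Adj : V → V → Prop) : ℕ :=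
  sSup {m | ∃ S : Finset V, S.card = m ∧
    ¬ ∃ (t : ℕ) (ht : 0 < t) (w : Fin t → V), Function.Injective w ∧
      (∀ i, w i ∈ S) ∧
      ∀ i : Fin t, Adj (w i) (w ⟨(i.1 + 1) % t, Nat.mod_lt _ ht⟩)}

/-- `τ(G)`: the minimum size of a vertex set intersecting every cycle. -/
noncomputable def cycleTransMin {V : Type*} [Fintype V] (Adj : V → V → Prop) : ℕ :=
  sInf {m | ∃ S : Finset V, S.card = m ∧
    ∀ (t : ℕ) (ht : 0 < t) (w : Fin t → V), Function.Injective w →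
      (∀ i : Fin t, Adj (w i) (w ⟨(i.1 + 1) % t, Nat.mod_lt _ ht⟩)) →
      ∃ i, w i ∈ S}

/-- `p` and `q` are the positions of the largest and the second largest of the
entries `a 0, …, a (r - 1)`. -/
def IsTopTwo (r : ℕ) (a : ℕ → ℕ) (p q : ℕ) : Prop :=
  p < r ∧ q < r ∧ a q < a p ∧ ∀ j < r, j ≠ p → j ≠ q → a j < a q

/-- The `(r-1)`-suffix of `a` pattern-matches the `(r-1)`-prefix of `b`. -/
def IsPatternShift (r : ℕ) (a b : ℕ → ℕ) : Prop :=
  ∀ i j, i + 1 < r → j + 1 < r → (a (i + 1) < a (j + 1) ↔ b i < b j)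

/-- The pattern of the `t` entries that follow position `p`, encoded as a natural number. -/
noncomputable def followCode (t : ℕ) (a : ℕ → ℕ) (p : ℕ) : ℕ :=
  Fintype.equivFin (Equiv.Perm (Fin t)) (Tuple.sort fun i : Fin t => a (p + 1 + i))

/-- Position pairs of the two largest entries at which a window is always put into the
transversal. -/
def IsBoundaryPair (r t p q : ℕ) : Prop :=
  (p = 0 ∧ (q ≤ t ∨ r ≤ q + t)) ∨ (p + 1 = r ∧ (q < t ∨ r ≤ q + t + 1)) ∨
    (p + t + 1 = r ∧ r ≤ q + 2 * t + 1)

/-- The windows `a` that form the transversal, in terms of the positions `p`, `q` of their two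
largest entries. -/
def IsHit (r t : ℕ) (a : ℕ → ℕ) (p q : ℕ) : Prop :=
  IsBoundaryPair r t p q ∨
    (p = 0 ∧ t < q ∧ q + t < r ∧ followCode t a q ≤ followCode t a p) ∨
    (p + t + 1 = r ∧ q + 2 * t + 1 < r ∧ followCode t a p ≤ followCode t a q)

theorem followCode_lt (t : ℕ) (a : ℕ → ℕ) (p : ℕ) :
    followCode t a p < Fintype.card (Equiv.Perm (Fin t)) :=
  Fin.isLt _

theorem followCode_eq_iff {t : ℕ} {a b : ℕ → ℕ} {p q : ℕ} :
    followCode t a p = followCode t b q ↔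
      Tuple.sort (fun i : Fin t => a (p + 1 + i)) =
        Tuple.sort (fun i : Fin t => b (q + 1 + i)) := by
  simp [followCode, Fin.val_inj]

theorem Tuple.sort_congr_of_lt_iff {n : ℕ} {f g : Fin n → ℕ}
    (h : ∀ i j, f i < f j ↔ g i < g j) : Tuple.sort f = Tuple.sort g := by
  rw [Tuple.eq_sort_iff]
  obtain ⟨h1, h2⟩ := Tuple.eq_sort_iff.1 (rfl : Tuple.sort f = Tuple.sort f)
  refine ⟨fun i j hij => ?_, fun i j hij he => h2 i j hij ?_⟩
  · have := h1 hij
    have := h (Tuple.sort f j) (Tuple.sort f i)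
    simp only [Function.comp_apply] at *
    omega
  · have := h (Tuple.sort f j) (Tuple.sort f i)
    have := h (Tuple.sort f i) (Tuple.sort f j)
    omega

theorem Tuple.mul_sort_comp_perm {n : ℕ} {f : Fin n → ℕ} (hf : Function.Injective f)
    (g : Equiv.Perm (Fin n)) : g * Tuple.sort (f ∘ g) = Tuple.sort f := by
  ext1 i
  exact hf (congrFun (Tuple.comp_perm_comp_sort_eq_comp_sort (f := f) (σ := g)) i)

theorem IsPatternShift.followCode_eq {r t p : ℕ} {a b : ℕ → ℕ} (h : IsPatternShift r a b)
    (hp : p + 1 + t < r) : followCode t b p = followCode t a (p + 1) := by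
  refine followCode_eq_iff.2 (Tuple.sort_congr_of_lt_iff fun i j => ?_)
  have := h (p + 1 + i) (p + 1 + j) (by omega) (by omega)
  rw [← this]
  simp only [add_right_comm _ 1]

theorem IsTopTwo.unique {r p q p' q' : ℕ} {a : ℕ → ℕ} (h : IsTopTwo r a p q)
    (h' : IsTopTwo r a p' q') : p = p' ∧ q = q' := by
  obtain ⟨h1, h2, h3, h4⟩ := h
  obtain ⟨h1', h2', h3', h4'⟩ := h'
  grind

theorem IsTopTwo.shift_of_pos {r p q p' q' : ℕ} {a b : ℕ → ℕ} (h : IsPatternShift r a b)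
    (ha : IsTopTwo r a p q) (hb : IsTopTwo r b p' q') (hp : 0 < p) :
    (p' + 1 = p ∧ (q' + 1 = q ∨ q' + 1 = r ∨ q = 0)) ∨ (p' + 1 = r ∧ q' + 1 = p) := by
  obtain ⟨h1, h2, h3, h4⟩ := ha
  obtain ⟨h1', h2', h3', h4'⟩ := hb
  obtain ⟨p, rfl⟩ : ∃ k, p = k + 1 := ⟨p - 1, by omega⟩
  have top : ∀ j, j + 1 < r → j ≠ p → b j < b p := fun j hj hjp => by
    have := h j p hj h1
    grind
  by_cases hpp : p' = p
  · subst hpp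
    left
    refine ⟨rfl, ?_⟩
    rcases Nat.eq_zero_or_pos q with rfl | hq
    · simp
    obtain ⟨q, rfl⟩ : ∃ k, q = k + 1 := ⟨q - 1, by omega⟩
    by_contra! hc
    have := h q q' h2 (by omega)
    have := h4 (q' + 1) (by omega) (by grind) (by omega)
    have := h4' q (by omega) (by grind) (by omega)
    omega
  · right
    have hr : p' + 1 = r := by
      by_contra hne
      have := top p' (by omega) hpp
      grind
    refine ⟨hr, ?_⟩
    by_contra hne
    have := top q' (by grind) (by omega)
    have := h4' p (by omega) (by omega) (by omega)
    omega

theorem IsTopTwo.shift_of_zero {r q p' q' : ℕ} {a b : ℕ → ℕ} (h : IsPatternShift r a b)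
    (ha : IsTopTwo r a 0 q) (hb : IsTopTwo r b p' q') :
    p' + 1 = q ∨ (p' + 1 = r ∧ q' + 1 = q) := by
  obtain ⟨h1, h2, h3, h4⟩ := ha
  obtain ⟨h1', h2', h3', h4'⟩ := hb
  obtain ⟨q, rfl⟩ : ∃ k, q = k + 1 := ⟨q - 1, by grind⟩
  have top : ∀ j, j + 1 < r → j ≠ q → b j < b q := fun j hj hjq => by
    have := h j q hj h2
    grind
  by_cases hpq : p' = q
  · simp [hpq]
  · right
    have hr : p' + 1 = r := by
      by_contra hne
      have := top p' (by omega) hpq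
      grind
    refine ⟨hr, ?_⟩
    by_contra hne
    have := top q' (by grind) (by omega)
    have := h4' q (by omega) (by omega) (by omega)
    omega

section Walk

variable {r t : ℕ} {a : ℕ → ℕ → ℕ} {P Q : ℕ → ℕ}

theorem followCode_shift_iterate (hs : ∀ n, IsPatternShift r (a n) (a (n + 1))) (n p k : ℕ)
    (hp : p + k + t < r) : followCode t (a (n + k)) p = followCode t (a n) (p + k) := by
  induction k generalizing p with
  | zero => rfl
  | succ k ih =>
    rw [← add_assoc, (hs (n + k)).followCode_eq (by omega), ih _ (by omega)]
    congr 1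
    omega

theorem exists_followCode_lt_of_record (hr : 3 * t + 2 ≤ r)
    (hs : ∀ n, IsPatternShift r (a n) (a (n + 1))) (hT : ∀ n, IsTopTwo r (a n) (P n) (Q n))
    (hH : ∀ n, ¬ IsHit r t (a n) (P n) (Q n)) (n : ℕ) (hn : P n + 1 = r) :
    P (n + t) + t < r ∧ followCode t (a n) (Q n) < followCode t (a (n + t)) (P (n + t)) := by
  have hB : ∀ m, ¬ IsBoundaryPair r t (P m) (Q m) := fun m h => hH m (Or.inl h)
  have hn' := hB n
  simp only [IsBoundaryPair] at hB hn'
  have key : ∀ k ≤ t, P (n + k) + 1 + k = r ∧ (Q (n + k) + k = Q n ∨ r ≤ Q (n + k) + k) := by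
    intro k
    induction k with
    | zero => intro _; exact ⟨hn, Or.inl rfl⟩
    | succ k ih =>
      intro hk
      have h1 := ih (by omega)
      have h2 := (hT (n + k)).shift_of_pos (hs _) (hT (n + k + 1)) (by omega)
      have h3 := hB (n + k + 1)
      rw [show n + (k + 1) = n + k + 1 from rfl]
      omega
  obtain ⟨h1, h2⟩ := key t le_rfl
  have h3 := hB (n + t)
  have h4 := hH (n + t)
  simp only [IsHit, not_or] at h4
  have h5 := followCode_shift_iterate (t := t) hs n (Q (n + t)) t (by omega)
  have h6 : Q (n + t) + t = Q n := by omega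
  rw [h6] at h5
  have h7 := h4.2.2
  rw [h5] at h7
  omega

theorem exists_followCode_lt (hr : 3 * t + 2 ≤ r)
    (hs : ∀ n, IsPatternShift r (a n) (a (n + 1))) (hT : ∀ n, IsTopTwo r (a n) (P n) (Q n))
    (hH : ∀ n, ¬ IsHit r t (a n) (P n) (Q n)) (n : ℕ) (hn : P n + t < r) :
    ∃ m, P m + t < r ∧ followCode t (a n) (P n) < followCode t (a m) (P m) := by
  induction hp : P n generalizing n with
  | zero =>
    have h1 := hH n
    simp only [IsHit, IsBoundaryPair, hp, true_and] at h1
    have h2 : followCode t (a n) 0 < followCode t (a n) (Q n) := by omega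
    have h3 := hT n
    rw [hp] at h3
    rcases h3.shift_of_zero (hs n) (hT (n + 1)) with h4 | ⟨h4, h5⟩
    · refine ⟨n + 1, by omega, ?_⟩
      rwa [(hs n).followCode_eq (by omega), h4]
    · obtain ⟨h6, h7⟩ := exists_followCode_lt_of_record hr hs hT hH (n + 1) h4
      refine ⟨_, h6, lt_trans ?_ h7⟩
      rwa [(hs n).followCode_eq (by omega), h5]
  | succ p ih =>
    rcases (hT n).shift_of_pos (hs n) (hT (n + 1)) (by omega) with ⟨h4, -⟩ | ⟨h4, h5⟩
    · obtain ⟨m, h6, h7⟩ := ih (n + 1) (by omega) (by omega)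
      rw [(hs n).followCode_eq (by omega)] at h7
      exact ⟨m, h6, h7⟩
    · obtain ⟨h6, h7⟩ := exists_followCode_lt_of_record hr hs hT hH (n + 1) h4
      rw [(hs n).followCode_eq (by omega), h5, hp] at h7
      exact ⟨_, h6, h7⟩

theorem exists_isHit (hr : 3 * t + 2 ≤ r)
    (hs : ∀ n, IsPatternShift r (a n) (a (n + 1))) (hT : ∀ n, IsTopTwo r (a n) (P n) (Q n)) :
    ∃ n, IsHit r t (a n) (P n) (Q n) := by
  by_contra! hH
  have start : ∃ n, P n + t < r := by
    by_contra! hc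
    have h : ∀ n, P n + n = P 0 := by
      intro n
      induction n with
      | zero => rfl
      | succ n ih =>
        have h1 := (hT n).shift_of_pos (hs n) (hT (n + 1)) (by have := hc n; omega)
        have h2 := hH (n + 1)
        have h3 := hc n
        simp only [IsHit, IsBoundaryPair] at h2
        omega
    have := h (P 0 + 1)
    omega
  have unbounded : ∀ k, ∃ n, P n + t < r ∧ k ≤ followCode t (a n) (P n) := by
    intro k
    induction k with
    | zero => simpa using start
    | succ k ih =>
      obtain ⟨n, h1, h2⟩ := ih
      obtain ⟨m, h3, h4⟩ := exists_followCode_lt hr hs hT hH n h1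
      exact ⟨m, h3, by omega⟩
  obtain ⟨n, -, h⟩ := unbounded (Fintype.card (Equiv.Perm (Fin t)))
  exact absurd (followCode_lt t (a n) (P n)) (by omega)

end Walk

/-- The entries of a permutation of `Fin r`, extended by zero. -/
def permEntries {r : ℕ} (σ : Equiv.Perm (Fin r)) (i : ℕ) : ℕ :=
  if h : i < r then σ ⟨i, h⟩ else 0

theorem permEntries_val {r : ℕ} (σ : Equiv.Perm (Fin r)) (i : Fin r) :
    permEntries σ i = σ i := by
  simp [permEntries]

theorem permEntries_mul {r : ℕ} (σ g : Equiv.Perm (Fin r)) (i : Fin r) :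
    permEntries (σ * g) i = permEntries σ (g i) := by
  simp [permEntries]

theorem permEntries_injOn {r : ℕ} (σ : Equiv.Perm (Fin r)) {i j : ℕ} (hi : i < r) (hj : j < r)
    (h : permEntries σ i = permEntries σ j) : i = j := by
  simpa [permEntries, hi, hj, Fin.val_inj] using h

theorem PSGAdj.isPatternShift {r : ℕ} {σ τ : Equiv.Perm (Fin r)} (h : PSGAdj r σ τ) :
    IsPatternShift r (permEntries σ) (permEntries τ) := by
  intro i j hi hj
  have := h i j hi hj
  simpa [permEntries, hi, hj, Nat.lt_of_succ_lt hi, Nat.lt_of_succ_lt hj] using this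

theorem exists_isTopTwo {r : ℕ} (hr : 2 ≤ r) (σ : Equiv.Perm (Fin r)) :
    ∃ p q, IsTopTwo r (permEntries σ) p q := by
  refine ⟨σ.symm ⟨r - 1, by omega⟩, σ.symm ⟨r - 2, by omega⟩, Fin.isLt _, Fin.isLt _, ?_, ?_⟩
  · simp only [permEntries_val, Equiv.apply_symm_apply]
    omega
  · intro j hj h1 h2
    have h3 := permEntries_injOn σ hj (Fin.isLt (σ.symm ⟨r - 1, by omega⟩))
    have h4 := permEntries_injOn σ hj (Fin.isLt (σ.symm ⟨r - 2, by omega⟩))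
    have h5 : permEntries σ j < r := by simp [permEntries, hj]
    simp only [permEntries_val, Equiv.apply_symm_apply] at *
    omega

theorem exists_isHit_of_cycle {r t T : ℕ} (hr : 3 * t + 2 ≤ r) (hT : 0 < T)
    (w : Fin T → Equiv.Perm (Fin r))
    (hw : ∀ i : Fin T, PSGAdj r (w i) (w ⟨(i.1 + 1) % T, Nat.mod_lt _ hT⟩)) :
    ∃ i p q, IsTopTwo r (permEntries (w i)) p q ∧ IsHit r t (permEntries (w i)) p q := by
  choose P Q hPQ using fun i => exists_isTopTwo (by omega) (w i)
  let c : ℕ → Fin T := fun n => ⟨n % T, Nat.mod_lt _ hT⟩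
  obtain ⟨n, hn⟩ := exists_isHit (t := t) (a := fun n => permEntries (w (c n)))
    (P := fun n => P (c n)) (Q := fun n => Q (c n)) hr
    (fun n => by simpa [c] using (hw (c n)).isPatternShift) (fun n => hPQ (c n))
  exact ⟨c n, _, _, hPQ _, hn⟩

open Classical in
/-- The permutations of `Fin r` whose two largest entries are at positions `p` and `q`. -/
noncomputable def topTwoPerms (r p q : ℕ) : Finset (Equiv.Perm (Fin r)) :=
  {σ | IsTopTwo r (permEntries σ) p q}

theorem mem_topTwoPerms {r p q : ℕ} {σ : Equiv.Perm (Fin r)} :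
    σ ∈ topTwoPerms r p q ↔ IsTopTwo r (permEntries σ) p q := by
  simp [topTwoPerms]

theorem IsTopTwo.mul_perm {r : ℕ} {p q : Fin r} {σ g : Equiv.Perm (Fin r)}
    (h : IsTopTwo r (permEntries σ) (g p) (g q)) : IsTopTwo r (permEntries (σ * g)) p q := by
  obtain ⟨-, -, h3, h4⟩ := h
  refine ⟨p.isLt, q.isLt, by simpa [permEntries_mul] using h3, fun j hj h1 h2 => ?_⟩
  have := h4 (g ⟨j, hj⟩) (Fin.isLt _) (by simpa [Fin.ext_iff, Fin.val_inj] using h1)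
    (by simpa [Fin.ext_iff, Fin.val_inj] using h2)
  rw [← permEntries_mul, ← permEntries_mul] at this
  exact this

theorem card_topTwoPerms_le_of_ne {r : ℕ} {p q p' q' : Fin r} (h : p ≠ q) (h' : p' ≠ q') :
    (topTwoPerms r p q).card ≤ (topTwoPerms r p' q').card := by
  obtain ⟨g, h1, h2⟩ : ∃ g : Equiv.Perm (Fin r), g p' = p ∧ g q' = q := by
    refine ⟨Equiv.swap (Equiv.swap p' p q') q * Equiv.swap p' p, ?_, by simp⟩
    have : Equiv.swap p' p q' ≠ p :=
      fun hc => h' (by simpa using congrArg (Equiv.swap p' p) hc.symm)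
    simp [Equiv.swap_apply_of_ne_of_ne this.symm h]
  refine Finset.card_le_card_of_injOn (· * g) (fun σ hσ => ?_) fun σ _ τ _ hst => by simpa using hst
  simp only [Finset.mem_coe, mem_topTwoPerms] at hσ ⊢
  exact IsTopTwo.mul_perm (by rwa [h1, h2])

theorem mul_card_topTwoPerms_le (r p q : ℕ) :
    r * (r - 1) * (topTwoPerms r p q).card ≤ r.factorial := by
  classical
  rcases (topTwoPerms r p q).eq_empty_or_nonempty with h | ⟨σ, hσ⟩
  · simp [h]
  rw [mem_topTwoPerms] at hσ
  have hpq : (⟨p, hσ.1⟩ : Fin r) ≠ ⟨q, hσ.2.1⟩ := fun h => by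
    have := hσ.2.2.1
    rw [Fin.mk.inj h] at this
    omega
  have hdis : ((Finset.univ : Finset (Fin r)).offDiag : Set (Fin r × Fin r)).PairwiseDisjoint
      fun x => topTwoPerms r x.1 x.2 := by
    intro x _ y _ hxy
    refine Finset.disjoint_left.2 fun τ h1 h2 => hxy ?_
    have := (mem_topTwoPerms.1 h1).unique (mem_topTwoPerms.1 h2)
    exact Prod.ext (Fin.ext this.1) (Fin.ext this.2)
  calc r * (r - 1) * (topTwoPerms r p q).card
      = ∑ _x ∈ (Finset.univ : Finset (Fin r)).offDiag, (topTwoPerms r p q).card := by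
        simp [Finset.offDiag_card, Nat.mul_sub]
    _ ≤ ∑ x ∈ (Finset.univ : Finset (Fin r)).offDiag, (topTwoPerms r x.1 x.2).card :=
        Finset.sum_le_sum fun x hx =>
          card_topTwoPerms_le_of_ne hpq (Finset.mem_offDiag.1 hx).2.2
    _ = _ := (Finset.card_biUnion hdis).symm
    _ ≤ r.factorial := (Finset.card_le_univ _).trans (by simp [Fintype.card_perm])

theorem permEntries_mul_mk {r : ℕ} {σ g : Equiv.Perm (Fin r)} {i j : ℕ} (hi : i < r) (hj : j < r)
    (h : g ⟨i, hi⟩ = ⟨j, hj⟩) : permEntries (σ * g) i = permEntries σ j := by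
  simpa [h] using permEntries_mul σ g ⟨i, hi⟩

theorem mul_mem_topTwoPerms {r p q : ℕ} {σ g : Equiv.Perm (Fin r)} (hσ : σ ∈ topTwoPerms r p q)
    (hp : ∀ h : p < r, g ⟨p, h⟩ = ⟨p, h⟩) (hq : ∀ h : q < r, g ⟨q, h⟩ = ⟨q, h⟩) :
    σ * g ∈ topTwoPerms r p q := by
  rw [mem_topTwoPerms] at hσ ⊢
  refine IsTopTwo.mul_perm (p := ⟨p, hσ.1⟩) (q := ⟨q, hσ.2.1⟩) ?_
  rwa [hp, hq]

theorem exists_perm_swap_blocks {r t p q : ℕ} (hp : p + t < r) (hq : q + t < r)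
    (hpq : p + t < q ∨ q + t < p) :
    ∃ g : Equiv.Perm (Fin r), (∀ h : p < r, g ⟨p, h⟩ = ⟨p, h⟩) ∧
      (∀ h : q < r, g ⟨q, h⟩ = ⟨q, h⟩) ∧
      ∀ i < t, (∀ h h', g ⟨p + 1 + i, h⟩ = ⟨q + 1 + i, h'⟩) ∧
        ∀ h h', g ⟨q + 1 + i, h⟩ = ⟨p + 1 + i, h'⟩ := by
  let f : Fin r → Fin r := fun x =>
    if h : p < x.1 ∧ x.1 ≤ p + t then ⟨x.1 - p + q, by omega⟩
    else if h : q < x.1 ∧ x.1 ≤ q + t then ⟨x.1 - q + p, by omega⟩ else x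
  have hf : Function.Involutive f := by
    intro x
    grind
  refine ⟨hf.toPerm, fun h => ?_, fun h => ?_, fun i hi => ⟨fun h h' => ?_, fun h h' => ?_⟩⟩ <;>
  · simp only [Function.Involutive.coe_toPerm, f, Fin.ext_iff]
    split_ifs <;> simp_all <;> omega

theorem two_mul_card_filter_followCode_le {r t p q x y : ℕ} (hp : p + t < r) (hq : q + t < r)
    (hpq : p + t < q ∨ q + t < p) (hx : x = p ∨ x = q)
    (hy : y = p ∨ y = q) :
    2 * ((topTwoPerms r x y).filter fun σ =>
        followCode t (permEntries σ) p ≤ followCode t (permEntries σ) q).card ≤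
      (topTwoPerms r x y).card + ((topTwoPerms r x y).filter fun σ =>
        followCode t (permEntries σ) p = followCode t (permEntries σ) q).card := by
  classical
  obtain ⟨g, hgp, hgq, hg⟩ := exists_perm_swap_blocks hp hq hpq
  have hcp : ∀ σ, followCode t (permEntries (σ * g)) p = followCode t (permEntries σ) q := by
    intro σ
    refine followCode_eq_iff.2 (congrArg _ (funext fun i => ?_))
    exact permEntries_mul_mk (by omega) (by omega) ((hg i i.isLt).1 _ _)
  have hcq : ∀ σ, followCode t (permEntries (σ * g)) q = followCode t (permEntries σ) p := by
    intro σ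
    refine followCode_eq_iff.2 (congrArg _ (funext fun i => ?_))
    exact permEntries_mul_mk (by omega) (by omega) ((hg i i.isLt).2 _ _)
  have hle : ((topTwoPerms r x y).filter fun σ =>
      followCode t (permEntries σ) p ≤ followCode t (permEntries σ) q).card ≤
      ((topTwoPerms r x y).filter fun σ =>
      followCode t (permEntries σ) q ≤ followCode t (permEntries σ) p).card := by
    refine Finset.card_le_card_of_injOn (· * g) (fun σ hσ => ?_)
      fun σ _ τ _ h => by simpa using h
    simp only [Finset.coe_filter, Set.mem_ofPred_eq] at hσ ⊢
    exact ⟨mul_mem_topTwoPerms hσ.1 (by rcases hx with rfl | rfl <;> assumption)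
      (by rcases hy with rfl | rfl <;> assumption), by rw [hcp, hcq]; exact hσ.2⟩
  have hsum := Finset.card_union_add_card_inter ((topTwoPerms r x y).filter fun σ =>
      followCode t (permEntries σ) p ≤ followCode t (permEntries σ) q)
    ((topTwoPerms r x y).filter fun σ =>
      followCode t (permEntries σ) q ≤ followCode t (permEntries σ) p)
  rw [← Finset.filter_or, ← Finset.filter_and] at hsum
  simp only [← le_antisymm_iff] at hsum
  have := Finset.card_filter_le (topTwoPerms r x y) fun σ =>
    followCode t (permEntries σ) p ≤ followCode t (permEntries σ) q ∨
      followCode t (permEntries σ) q ≤ followCode t (permEntries σ) p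
  omega

theorem factorial_mul_card_filter_followCode_eq_le {r t p q x y : ℕ} (hp : p + t < r)
    (hq : q + t < r) (hpq : p + t < q ∨ q + t < p) (hx : x = p ∨ x = q)
    (hy : y = p ∨ y = q) :
    t.factorial * ((topTwoPerms r x y).filter fun σ =>
        followCode t (permEntries σ) p = followCode t (permEntries σ) q).card ≤
      (topTwoPerms r x y).card := by
  classical
  let e : Fin t ↪ Fin r := ⟨fun i => ⟨q + 1 + i, by omega⟩, fun i j h => by
    simpa [Fin.ext_iff] using h⟩
  let v : Equiv.Perm (Fin t) → Equiv.Perm (Fin r) := fun g => g.viaFintypeEmbedding e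
  have hv : ∀ g i, v g (e i) = e (g i) := fun g i =>
    Equiv.Perm.viaFintypeEmbedding_apply_image g e i
  have hv' : ∀ g x, (∀ h : x < r, x ≤ q ∨ q + t < x → v g ⟨x, h⟩ = ⟨x, h⟩) := by
    intro g x h hx
    refine Equiv.Perm.viaFintypeEmbedding_apply_notMem_range g e ?_
    rintro ⟨i, hi⟩
    have : q + 1 + i = x := congrArg Fin.val hi
    omega
  have hcp : ∀ σ g, (Tuple.sort fun i : Fin t => permEntries (σ * v g) (p + 1 + i)) =
      Tuple.sort fun i : Fin t => permEntries σ (p + 1 + i) := fun σ g =>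
    congrArg _ <| funext fun i => permEntries_mul_mk (by omega) (by omega) (hv' g _ _ (by omega))
  have hcq : ∀ σ g, g * (Tuple.sort fun i : Fin t => permEntries (σ * v g) (q + 1 + i)) =
      Tuple.sort fun i : Fin t => permEntries σ (q + 1 + i) := by
    intro σ g
    rw [← Tuple.mul_sort_comp_perm (f := fun i : Fin t => permEntries σ (q + 1 + i)) _ g]
    · congr 2
      exact funext fun i => permEntries_mul_mk (by omega) (by omega) (hv g i)
    · intro i j h
      have := permEntries_injOn σ (by omega) (by omega) h
      omega
  calc t.factorial * ((topTwoPerms r x y).filter fun σ =>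
        followCode t (permEntries σ) p = followCode t (permEntries σ) q).card
      = ((Finset.univ : Finset (Equiv.Perm (Fin t))) ×ˢ (topTwoPerms r x y).filter fun σ =>
        followCode t (permEntries σ) p = followCode t (permEntries σ) q).card := by
        simp [Finset.card_product, Fintype.card_perm]
    _ ≤ (topTwoPerms r x y).card := by
        refine Finset.card_le_card_of_injOn (fun x => x.2 * v x.1) ?_ ?_
        · rintro ⟨g, σ⟩ hσ
          simp only [Finset.coe_product, Finset.coe_filter, Set.mem_prod, Set.mem_ofPred_eq] at hσ
          exact mul_mem_topTwoPerms hσ.2.1 (fun h => hv' g x h (by omega))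
            fun h => hv' g y h (by omega)
        · rintro ⟨g, σ⟩ hσ ⟨g', σ'⟩ hσ' h
          simp only [Finset.coe_product, Finset.coe_filter, Set.mem_prod, Set.mem_ofPred_eq,
            followCode_eq_iff] at hσ hσ' h
          have h1 := hcq σ g
          have h2 := hcq σ' g'
          rw [← hσ.2.2, ← hcp σ g, h] at h1
          rw [← hσ'.2.2, ← hcp σ' g'] at h2
          have hg : g = g' := mul_right_cancel (h1.trans h2.symm)
          subst hg
          exact Prod.ext rfl (mul_right_cancel h)

theorem card_topTwoPerms_le {r : ℕ} (hr : 2 ≤ r) (p q : ℕ) :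
    ((topTwoPerms r p q).card : ℚ) ≤ r.factorial / (r * (r - 1)) := by
  have hr' : (2 : ℚ) ≤ r := by exact_mod_cast hr
  rw [le_div_iff₀ (by nlinarith), mul_comm]
  have := mul_card_topTwoPerms_le r p q
  rw [← Nat.cast_le (α := ℚ)] at this
  push_cast [Nat.cast_sub (by omega : 1 ≤ r)] at this
  exact this

theorem card_filter_followCode_le {r t p q x y : ℕ} (hp : p + t < r)
    (hq : q + t < r) (hpq : p + t < q ∨ q + t < p) (hx : x = p ∨ x = q)
    (hy : y = p ∨ y = q) :
    (((topTwoPerms r x y).filter fun σ =>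
        followCode t (permEntries σ) p ≤ followCode t (permEntries σ) q).card : ℚ) ≤
      r.factorial / (r * (r - 1)) * ((1 + 1 / t.factorial) / 2) := by
  have h1 := two_mul_card_filter_followCode_le hp hq hpq hx hy
  have h2 := factorial_mul_card_filter_followCode_eq_le hp hq hpq hx hy
  have h3 := card_topTwoPerms_le (r := r) (by omega) x y
  have ht : (0 : ℚ) < t.factorial := by exact_mod_cast t.factorial_pos
  rw [← Nat.cast_le (α := ℚ)] at h1 h2
  push_cast at h1 h2
  rw [mul_comm, ← le_div_iff₀ ht] at h2
  have h4 := div_le_div_of_nonneg_right h3 ht.le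
  have h5 : (r.factorial / (r * (r - 1)) * ((1 + 1 / t.factorial) / 2) : ℚ) =
      (r.factorial / (r * (r - 1)) + r.factorial / (r * (r - 1)) / t.factorial) / 2 := by ring
  linarith

/-- Position pairs covering those of `IsBoundaryPair`. -/
def boundaryPairs (r t : ℕ) : Finset (ℕ × ℕ) :=
  ({0} ×ˢ (Finset.range (t + 1) ∪ Finset.Ico (r - t) r) ∪
    {r - 1} ×ˢ (Finset.range t ∪ Finset.Ico (r - t - 1) r)) ∪
    {r - t - 1} ×ˢ Finset.Ico (r - 2 * t - 1) r

theorem IsBoundaryPair.mem_boundaryPairs {r t p q : ℕ} (h : IsBoundaryPair r t p q)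
    (hq : q < r) : (p, q) ∈ boundaryPairs r t := by
  simp only [IsBoundaryPair] at h
  simp only [boundaryPairs, Finset.mem_union, Finset.mem_product, Finset.mem_singleton,
    Finset.mem_range, Finset.mem_Ico]
  omega

theorem card_boundaryPairs_le {r t : ℕ} (hr : 3 * t + 2 ≤ r) :
    (boundaryPairs r t).card ≤ 6 * (3 * t + 2) := by
  have h1 := Finset.card_union_le (Finset.range (t + 1)) (Finset.Ico (r - t) r)
  have h2 := Finset.card_union_le (Finset.range t) (Finset.Ico (r - t - 1) r)
  refine (Finset.card_union_le _ _).trans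
    ((Nat.add_le_add_right (Finset.card_union_le _ _) _).trans ?_)
  simp only [Finset.card_product, Finset.card_singleton, Finset.card_range, Nat.card_Ico] at *
  omega

open Classical in
/-- A vertex set that intersects every cycle of the pattern-shift graph. -/
noncomputable def hitPerms (r t : ℕ) : Finset (Equiv.Perm (Fin r)) :=
  ((boundaryPairs r t).biUnion fun x => topTwoPerms r x.1 x.2) ∪
    ((Finset.Ico (t + 1) (r - t)).biUnion fun q => (topTwoPerms r 0 q).filter fun σ =>
      followCode t (permEntries σ) q ≤ followCode t (permEntries σ) 0) ∪
    ((Finset.range (r - 2 * t - 1)).biUnion fun q =>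
      (topTwoPerms r (r - t - 1) q).filter fun σ =>
        followCode t (permEntries σ) (r - t - 1) ≤ followCode t (permEntries σ) q)

theorem IsHit.mem_hitPerms {r t p q : ℕ} {σ : Equiv.Perm (Fin r)}
    (h : IsTopTwo r (permEntries σ) p q) (hh : IsHit r t (permEntries σ) p q) :
    σ ∈ hitPerms r t := by
  have hσ := mem_topTwoPerms.2 h
  simp only [hitPerms, Finset.mem_union, Finset.mem_biUnion, Finset.mem_filter, Finset.mem_Ico,
    Finset.mem_range]
  rcases hh with hB | ⟨rfl, h1, h2, h3⟩ | ⟨h1, h2, h3⟩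
  · exact Or.inl (Or.inl ⟨(p, q), hB.mem_boundaryPairs h.2.1, hσ⟩)
  · exact Or.inl (Or.inr ⟨q, by omega, hσ, h3⟩)
  · obtain rfl : p = r - t - 1 := by omega
    exact Or.inr ⟨q, by omega, hσ, h3⟩

theorem Finset.cast_card_biUnion_le {ι α : Type*} [DecidableEq α] (s : Finset ι)
    (f : ι → Finset α) {c : ℚ} (h : ∀ i ∈ s, ((f i).card : ℚ) ≤ c) :
    ((s.biUnion f).card : ℚ) ≤ s.card * c := by
  calc ((s.biUnion f).card : ℚ) ≤ ∑ i ∈ s, ((f i).card : ℚ) := by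
        exact_mod_cast Finset.card_biUnion_le
    _ ≤ s.card * c := by simpa using Finset.sum_le_sum h

theorem card_hitPerms_le {r t : ℕ} (hr : 3 * t + 2 ≤ r) :
    ((hitPerms r t).card : ℚ) ≤
      r.factorial / (r * (r - 1)) * (6 * (3 * t + 2) + (r - 1) * (1 + 1 / t.factorial)) := by
  classical
  have hr2 : (2 : ℚ) ≤ r := by exact_mod_cast (by omega : 2 ≤ r)
  set D : ℚ := r.factorial / (r * (r - 1)) with hD
  set c : ℚ := 1 + 1 / t.factorial with hc
  have hD0 : 0 ≤ D := div_nonneg (by positivity) (by nlinarith)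
  have hc0 : 0 ≤ c := by positivity
  have h1 := Finset.cast_card_biUnion_le (boundaryPairs r t)
    (fun x => topTwoPerms r x.1 x.2) (c := D) fun x _ => card_topTwoPerms_le (by omega) _ _
  have h2 := Finset.cast_card_biUnion_le (Finset.Ico (t + 1) (r - t))
    (fun q => (topTwoPerms r 0 q).filter fun σ =>
      followCode t (permEntries σ) q ≤ followCode t (permEntries σ) 0) (c := D * (c / 2))
    fun q hq => by
      rw [Finset.mem_Ico] at hq
      exact card_filter_followCode_le (by omega) (by omega) (by omega) (by omega) (by omega)
  have h3 := Finset.cast_card_biUnion_le (Finset.range (r - 2 * t - 1))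
    (fun q => (topTwoPerms r (r - t - 1) q).filter fun σ =>
      followCode t (permEntries σ) (r - t - 1) ≤ followCode t (permEntries σ) q)
    (c := D * (c / 2)) fun q hq => by
      rw [Finset.mem_range] at hq
      exact card_filter_followCode_le (by omega) (by omega) (by omega) (by omega) (by omega)
  have hB : ((boundaryPairs r t).card : ℚ) ≤ 6 * (3 * t + 2) := by
    exact_mod_cast card_boundaryPairs_le hr
  have hn : ∀ n ≤ r - 1, (n : ℚ) ≤ r - 1 := fun n hn => by
    rw [le_sub_iff_add_le]
    exact_mod_cast (by omega : n + 1 ≤ r)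
  have hB' := mul_le_mul_of_nonneg_right hB hD0
  have hM : 0 ≤ D * (c / 2) := by positivity
  have h2' := mul_le_mul_of_nonneg_right
    (hn (Finset.Ico (t + 1) (r - t)).card (by rw [Nat.card_Ico]; omega)) hM
  have h3' := mul_le_mul_of_nonneg_right
    (hn (Finset.range (r - 2 * t - 1)).card (by rw [Finset.card_range]; omega)) hM
  calc ((hitPerms r t).card : ℚ) ≤ _ + _ + _ := by
        exact_mod_cast (Finset.card_union_le _ _).trans
          (Nat.add_le_add_right (Finset.card_union_le _ _) _)
    _ ≤ 6 * (3 * t + 2) * D + (r - 1) * (D * (c / 2)) + (r - 1) * (D * (c / 2)) :=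
        add_le_add (add_le_add (h1.trans hB') (h2.trans h2')) (h3.trans h3')
    _ = D * (6 * (3 * t + 2) + (r - 1) * c) := by ring

theorem cycleTransMin_le_card_hitPerms {r t : ℕ} (hr : 3 * t + 2 ≤ r) :
    cycleTransMin (PSGAdj r) ≤ (hitPerms r t).card := by
  refine Nat.sInf_le ⟨_, rfl, fun T hT w _ hw => ?_⟩
  obtain ⟨i, p, q, h1, h2⟩ := exists_isHit_of_cycle (t := t) hr hT w hw
  exact ⟨i, h2.mem_hitPerms h1⟩

/-- Theorem: for `t ≥ 1` and `r ≥ max{3t+2, 3}`,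
`τ(PSG_r) ≤ r!·(1/r + 1/(r·t!) + 6(3t+2)/(r(r−1)))`. -/
theorem stmt7 (r t : ℕ) (ht : 1 ≤ t) (hr1 : 3 * t + 2 ≤ r) (hr2 : 3 ≤ r) :
    (cycleTransMin (PSGAdj r) : ℚ) ≤
      (r.factorial : ℚ) * (1 / (r : ℚ) + 1 / ((r : ℚ) * (t.factorial : ℚ)) +
        6 * (3 * (t : ℚ) + 2) / ((r : ℚ) * ((r : ℚ) - 1))) := by
  have hr : (3 : ℚ) ≤ r := by exact_mod_cast hr2
  have h0 : (r : ℚ) ≠ 0 := by linarith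
  have h1 : (r : ℚ) - 1 ≠ 0 := by linarith
  have ht0 : (t.factorial : ℚ) ≠ 0 := by exact_mod_cast t.factorial_ne_zero
  calc (cycleTransMin (PSGAdj r) : ℚ) ≤ (hitPerms r t).card := by
        exact_mod_cast cycleTransMin_le_card_hitPerms hr1
    _ ≤ _ := card_hitPerms_le hr1
    _ = _ := by
        field_simp
        ring
end

section
/- For r ≥ 2, the number of shift cycles of PSG_r that contain a chord or a loop equals φ(r), where φ is Euler's totient function, φ(r) = |{d ∈ {1,...,r} : gcd(d,r) = 1}|. -/
/-- The forward cyclic shift of a permutation viewed as a tuple: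
`(a_1,…,a_r) ↦ (a_2,…,a_r,a_1)`. -/
def forwardShift (r : ℕ) (u : Equiv.Perm (Fin r)) : Equiv.Perm (Fin r) :=
  (finRotate r).trans u

/-- The shift cycle (equivalence class under cyclic shifts) of a vertex of `PSG_r`. -/
def shiftClass (r : ℕ) (a : Equiv.Perm (Fin r)) : Set (Equiv.Perm (Fin r)) :=
  {b | ∃ k : ℕ, b = (forwardShift r)^[k] a}

open Fin.CommRing in
theorem forwardShift_iterate_apply {n : ℕ} (u : Equiv.Perm (Fin (n + 2))) (k : ℕ)
    (x : Fin (n + 2)) : (forwardShift (n + 2))^[k] u x = u (x + (k : Fin (n + 2))) := by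
  induction k generalizing x with
  | zero => simp
  | succ k ih =>
    rw [Function.iterate_succ_apply', forwardShift, Equiv.trans_apply, ih,
      finRotate_apply, Nat.cast_succ]
    congr 1
    ring

theorem mem_shiftClass_iff {n : ℕ} {a b : Equiv.Perm (Fin (n + 2))} :
    b ∈ shiftClass (n + 2) a ↔ ∃ k : Fin (n + 2), ∀ x, b x = a (x + k) := by
  constructor
  · rintro ⟨k, rfl⟩
    exact ⟨_, forwardShift_iterate_apply a k⟩
  · rintro ⟨k, hk⟩
    refine ⟨k.val, Equiv.ext fun x => ?_⟩
    rw [hk, forwardShift_iterate_apply, Fin.cast_val_eq_self]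

theorem shiftClass_eq_of_mem {n : ℕ} {a b : Equiv.Perm (Fin (n + 2))}
    (h : b ∈ shiftClass (n + 2) a) : shiftClass (n + 2) b = shiftClass (n + 2) a := by
  obtain ⟨k, hk⟩ := mem_shiftClass_iff.1 h
  ext c
  simp only [mem_shiftClass_iff]
  constructor
  · rintro ⟨l, hl⟩
    exact ⟨l + k, fun x => by rw [hl, hk, add_assoc]⟩
  · rintro ⟨l, hl⟩
    exact ⟨l - k, fun x => by rw [hl, hk]; congr 1; abel⟩

theorem psgAdj_iff {n : ℕ} {a b : Equiv.Perm (Fin (n + 2))} :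
    PSGAdj (n + 2) a b ↔
      ∀ x y : Fin (n + 2), x ≠ 0 → y ≠ 0 → (a x < a y ↔ b (x - 1) < b (y - 1)) := by
  have key (i : ℕ) (hi : i + 1 < n + 2) :
      (⟨i + 1, hi⟩ : Fin (n + 2)) - 1 = ⟨i, Nat.lt_of_succ_lt hi⟩ := by
    rw [sub_eq_iff_eq_add]
    ext
    simp [Fin.val_add, Nat.mod_eq_of_lt hi]
  constructor
  · intro h x y hx hy
    obtain ⟨i, rfl⟩ := Fin.exists_succ_eq.2 hx
    obtain ⟨j, rfl⟩ := Fin.exists_succ_eq.2 hy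
    have hi : i.val + 1 < n + 2 := by omega
    have hj : j.val + 1 < n + 2 := by omega
    have := h i j hi hj
    rw [← key _ hi, ← key _ hj] at this
    exact this
  · intro h i j hi hj
    rw [← key _ hi, ← key _ hj]
    exact h _ _ (by simp [Fin.ext_iff]) (by simp [Fin.ext_iff])

/-- A fixed-point-free permutation of `Fin (n + 2)` that is increasing away from a single point
rotates the values by one. -/
theorem eq_add_one_or_eq_sub_one {n : ℕ} (t : Equiv.Perm (Fin (n + 2))) (p : Fin (n + 2))
    (hfix : ∀ x, t x ≠ x) (hmono : ∀ x y, x ≠ p → y ≠ p → x < y → t x < t y) :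
    (∀ x, t x = x + 1) ∨ ∀ x, t x = x - 1 := by
  have low (i : ℕ) (hi : i < n + 2) (hip : i < p.val) : i < (t ⟨i, hi⟩).val := by
    induction i with
    | zero =>
      have := hfix ⟨0, hi⟩
      simp only [ne_eq, Fin.ext_iff] at this
      omega
    | succ i ih =>
      have h1 := ih (by omega) (by omega)
      have h2 := hmono ⟨i, by omega⟩ ⟨i + 1, hi⟩ (by simp [Fin.ext_iff]; omega)
        (by simp [Fin.ext_iff]; omega) (by simp [Fin.lt_def])
      have h3 := hfix ⟨i + 1, hi⟩
      simp only [ne_eq, Fin.ext_iff, Fin.lt_def] at h2 h3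
      omega
  have high (i : ℕ) (hi : p.val < n + 1 - i) :
      (t ⟨n + 1 - i, by omega⟩).val < n + 1 - i := by
    induction i with
    | zero =>
      have := hfix ⟨n + 1, by omega⟩
      simp only [ne_eq, Fin.ext_iff] at this
      simp only [Nat.sub_zero]
      omega
    | succ i ih =>
      have h1 := ih (by omega)
      have h2 := hmono ⟨n + 1 - (i + 1), by omega⟩ ⟨n + 1 - i, by omega⟩
        (by simp [Fin.ext_iff]; omega) (by simp [Fin.ext_iff]; omega)
        (by simp [Fin.lt_def]; omega)
      have h3 := hfix ⟨n + 1 - (i + 1), by omega⟩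
      simp only [ne_eq, Fin.ext_iff, Fin.lt_def] at h2 h3
      omega
  have high' (x : Fin (n + 2)) (hx : p < x) : t x < x := by
    have hx' : n + 1 - (n + 1 - x.val) = x.val := by omega
    have := high (n + 1 - x.val) (by rw [hx']; exact hx)
    simp only [hx'] at this
    exact this
  have low' (x : Fin (n + 2)) (hx : x < p) : x < t x := low x x.isLt hx
  have hp : p = 0 ∨ p = Fin.last (n + 1) := by
    by_contra! hp
    have h0 : 0 < p := Fin.pos_of_ne_zero hp.1
    have hl : p < Fin.last (n + 1) := Fin.lt_last_iff_ne_last.2 hp.2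
    have e1 : t.symm 0 = p := by
      by_contra hne
      rcases lt_or_gt_of_ne hne with h | h
      · have := low' _ h
        simp at this
      · have h1 := low' 0 h0
        have h2 := hmono 0 _ h0.ne h.ne' (h0.trans h)
        simp at h2
    have e2 : t.symm (Fin.last (n + 1)) = p := by
      by_contra hne
      rcases lt_or_gt_of_ne hne with h | h
      · have h2 := hmono _ (Fin.last (n + 1)) h.ne hl.ne' (h.trans hl)
        simp only [Equiv.apply_symm_apply] at h2
        exact absurd h2 (not_lt.2 (Fin.le_last _))
      · have := high' _ h
        simp only [Equiv.apply_symm_apply] at this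
        exact absurd this (not_lt.2 (Fin.le_last _))
    have := t.symm.injective (e1.trans e2.symm)
    simp [Fin.ext_iff] at this
  rcases hp with rfl | rfl
  · right
    have key (i : ℕ) (hi : i + 1 < n + 2) : i ≤ (t ⟨i + 1, hi⟩).val := by
      induction i with
      | zero => omega
      | succ i ih =>
        have h1 := ih (by omega)
        have h2 := hmono ⟨i + 1, by omega⟩ ⟨i + 1 + 1, hi⟩ (by simp [Fin.ext_iff])
          (by simp [Fin.ext_iff]) (by simp [Fin.lt_def])
        simp only [Fin.lt_def] at h2
        omega
    have main (x : Fin (n + 2)) (hx : x ≠ 0) : t x = x - 1 := by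
      have h1 := high' x (Fin.pos_of_ne_zero hx)
      obtain ⟨i, rfl⟩ := Fin.exists_succ_eq.2 hx
      have h2 := key i (by omega)
      rw [eq_sub_iff_add_eq]
      ext
      rw [Fin.lt_def] at h1
      change i.val ≤ (t i.succ).val at h2
      simp only [Fin.val_succ] at h1
      have : (t i.succ).val = i.val := by omega
      simp [Fin.val_add, this, Nat.le_of_lt_succ i.isLt]
    intro x
    by_cases hx : x = 0
    · subst hx
      by_contra hne
      have h1 : t 0 + 1 ≠ 0 := fun h => hne (by rw [eq_sub_iff_add_eq, h])
      have h2 := main _ h1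
      rw [add_sub_cancel_right] at h2
      exact h1 (t.injective h2)
    · exact main x hx
  · left
    have key (i : ℕ) (hi : i < n + 1) :
        (t ⟨n - i, by omega⟩).val ≤ n + 1 - i := by
      induction i with
      | zero => omega
      | succ i ih =>
        have h1 := ih (by omega)
        have h2 := hmono ⟨n - (i + 1), by omega⟩ ⟨n - i, by omega⟩
          (by simp [Fin.ext_iff]; omega) (by simp [Fin.ext_iff]; omega)
          (by simp [Fin.lt_def]; omega)
        simp only [Fin.lt_def] at h2
        omega
    have main (x : Fin (n + 2)) (hx : x ≠ Fin.last (n + 1)) : t x = x + 1 := by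
      have hlt := Fin.lt_last_iff_ne_last.2 hx
      have h1 := low' x hlt
      have hx1 : x.val < n + 1 := hlt
      have hx' : n - (n - x.val) = x.val := by omega
      have h2 := key (n - x.val) (by omega)
      simp only [hx'] at h2
      ext
      rw [Fin.lt_def] at h1
      rw [Fin.val_add_one_of_lt hlt]
      change (t x).val ≤ _ at h2
      omega
    intro x
    by_cases hx : x = Fin.last (n + 1)
    · subst hx
      by_contra hne
      have h1 : t (Fin.last (n + 1)) - 1 ≠ Fin.last (n + 1) :=
        fun h => hne (by rw [← sub_eq_iff_eq_add, h])
      have h2 := main _ h1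
      rw [sub_add_cancel] at h2
      exact h1 (t.injective h2)
    · exact main x hx

open Fin.CommRing in
/-- A permutation of `Fin (n + 2)` that turns the rotation by `d` into the rotation by a unit
is affine modulo `n + 2`. -/
theorem exists_unit_affine {n : ℕ} {u : Equiv.Perm (Fin (n + 2))} {d : Fin (n + 2)}
    (s : (Fin (n + 2))ˣ) (h : ∀ x, u (x + d) = u x + s) :
    ∃ e : (Fin (n + 2))ˣ, ∀ x, u x = e * x + u 0 := by
  have hk (k : ℕ) : u (k * d) = u 0 + k * s := by
    induction k with
    | zero => simp
    | succ k ih => rw [Nat.cast_succ, add_one_mul, h, ih]; ring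
  have hx (x : Fin (n + 2)) : x = (u x - u 0) * (↑s⁻¹ * d) := by
    apply u.injective
    have := hk ((u x - u 0) * ↑s⁻¹).val
    rw [Fin.cast_val_eq_self, mul_assoc, mul_assoc, Units.inv_mul] at this
    rw [this]
    ring
  have hd : (↑s⁻¹ * d) * (u 1 - u 0) = 1 := by rw [mul_comm]; exact (hx 1).symm
  refine ⟨⟨u 1 - u 0, ↑s⁻¹ * d, by rw [mul_comm]; exact hd, hd⟩, fun x => ?_⟩
  have h1 := hx x
  simp only
  linear_combination (u x - u 0) * (-hd) - (u 1 - u 0) * h1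

open Fin.CommRing in
/-- Multiplication by a unit modulo `n + 2`. -/
def unitPerm {n : ℕ} (e : (Fin (n + 2))ˣ) : Equiv.Perm (Fin (n + 2)) := Units.mulLeft e

open Fin.CommRing in
theorem unitPerm_apply {n : ℕ} (e : (Fin (n + 2))ˣ) (x : Fin (n + 2)) :
    unitPerm e x = e * x := rfl

open Fin.CommRing in
theorem shiftClass_unitPerm_injective {n : ℕ} :
    Function.Injective fun e : (Fin (n + 2))ˣ => shiftClass (n + 2) (unitPerm e) := by
  intro e f hef
  have hmem : unitPerm e ∈ shiftClass (n + 2) (unitPerm f) := by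
    rw [← show shiftClass (n + 2) (unitPerm e) = shiftClass (n + 2) (unitPerm f) from hef]
    exact ⟨0, rfl⟩
  obtain ⟨k, hk⟩ := mem_shiftClass_iff.1 hmem
  have h0 := hk 0
  have h1 := hk 1
  simp only [unitPerm_apply] at h0 h1
  ext1
  linear_combination h1 - h0

open Fin.CommRing in
theorem exists_shiftClass_eq_unitPerm {n : ℕ} {a u v : Equiv.Perm (Fin (n + 2))}
    (hu : u ∈ shiftClass (n + 2) a) (hv : v ∈ shiftClass (n + 2) a)
    (hadj : PSGAdj (n + 2) u v) (hne : v ≠ forwardShift (n + 2) u) :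
    ∃ e : (Fin (n + 2))ˣ, shiftClass (n + 2) (unitPerm e) = shiftClass (n + 2) a := by
  rw [← shiftClass_eq_of_mem hu] at hv ⊢
  obtain ⟨k, hk⟩ := mem_shiftClass_iff.1 hv
  have hd : k - 1 ≠ 0 := by
    intro h
    refine hne (Equiv.ext fun x => ?_)
    rw [hk, sub_eq_zero.1 h, forwardShift, Equiv.trans_apply, finRotate_apply]
  rw [psgAdj_iff] at hadj
  let t : Equiv.Perm (Fin (n + 2)) := (u.symm.trans (Equiv.addRight (k - 1))).trans u
  have ht (x : Fin (n + 2)) : t (u x) = u (x + (k - 1)) := by simp [t]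
  have hu' : ∃ s : (Fin (n + 2))ˣ, ∀ x, u (x + (k - 1)) = u x + s := by
    have hfix (y : Fin (n + 2)) : t y ≠ y := by
      intro hy
      obtain ⟨x, rfl⟩ := u.surjective y
      rw [ht] at hy
      exact hd (add_eq_left.1 (u.injective hy))
    have hmono (y z : Fin (n + 2)) (hy : y ≠ u 0) (hz : z ≠ u 0) (hyz : y < z) : t y < t z := by
      obtain ⟨x, rfl⟩ := u.surjective y
      obtain ⟨w, rfl⟩ := u.surjective z
      have := (hadj x w (fun h => hy (by rw [h])) (fun h => hz (by rw [h]))).1 hyz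
      rw [hk, hk] at this
      rw [ht, ht]
      convert this using 2 <;> ring
    rcases eq_add_one_or_eq_sub_one t (u 0) hfix hmono with h | h
    · exact ⟨1, fun x => by rw [← ht, h]; rfl⟩
    · exact ⟨-1, fun x => by rw [← ht, h, sub_eq_add_neg]; rfl⟩
  obtain ⟨s, hs⟩ := hu'
  obtain ⟨e, he⟩ := exists_unit_affine s hs
  refine ⟨e, (shiftClass_eq_of_mem (mem_shiftClass_iff.2 ⟨(e⁻¹).val * u 0, fun x => ?_⟩)).symm⟩
  rw [he, unitPerm_apply, mul_add, Units.mul_inv_cancel_left]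

open Fin.CommRing in
theorem exists_chord_unitPerm {n : ℕ} (e : (Fin (n + 2))ˣ) :
    ∃ v ∈ shiftClass (n + 2) (unitPerm e),
      PSGAdj (n + 2) (unitPerm e) v ∧ v ≠ forwardShift (n + 2) (unitPerm e) := by
  let v : Equiv.Perm (Fin (n + 2)) := (Equiv.addRight (1 - (e⁻¹).val)).trans (unitPerm e)
  have hv (x : Fin (n + 2)) : v x = unitPerm e (x + (1 - (e⁻¹).val)) := rfl
  have hv' (x : Fin (n + 2)) : v (x - 1) = unitPerm e x - 1 := by
    rw [hv, unitPerm_apply, unitPerm_apply]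
    linear_combination -e.mul_inv
  refine ⟨v, mem_shiftClass_iff.2 ⟨_, hv⟩, psgAdj_iff.2 fun x y hx hy => ?_, fun h => ?_⟩
  · rw [hv', hv']
    have hx' : unitPerm e x ≠ 0 := by simpa [unitPerm_apply] using hx
    have hy' : unitPerm e y ≠ 0 := by simpa [unitPerm_apply] using hy
    rw [Fin.lt_def, Fin.lt_def, Fin.val_sub_one_of_ne_zero hx', Fin.val_sub_one_of_ne_zero hy']
    have := Fin.pos_of_ne_zero hx'
    have := Fin.pos_of_ne_zero hy'
    simp only [Fin.lt_def, Fin.val_zero] at *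
    omega
  · have h0 := congrArg (fun w : Equiv.Perm (Fin (n + 2)) => w (0 - 1)) h
    simp only [hv', forwardShift, Equiv.trans_apply, finRotate_apply, sub_add_cancel] at h0
    simp at h0

open Fin.CommRing in
theorem setOf_shiftClass_with_chord_eq_range (n : ℕ) :
    {C : Set (Equiv.Perm (Fin (n + 2))) |
      (∃ a, C = shiftClass (n + 2) a) ∧
      ∃ u ∈ C, ∃ v ∈ C, PSGAdj (n + 2) u v ∧ v ≠ forwardShift (n + 2) u} =
      Set.range fun e : (Fin (n + 2))ˣ => shiftClass (n + 2) (unitPerm e) := by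
  ext C
  constructor
  · rintro ⟨⟨a, rfl⟩, u, hu, v, hv, hadj, hne⟩
    exact exists_shiftClass_eq_unitPerm hu hv hadj hne
  · rintro ⟨e, rfl⟩
    exact ⟨⟨_, rfl⟩, _, ⟨0, rfl⟩, exists_chord_unitPerm e⟩

open Fin.CommRing in
theorem card_units_fin (n : ℕ) : Nat.card (Fin (n + 2))ˣ = Nat.totient (n + 2) := by
  rw [← ZMod.card_units_eq_totient, ← Nat.card_eq_fintype_card]
  rfl

/-- Lemma: for `r ≥ 2`, the number of shift cycles of `PSG_r` containing a
chord or a loop (an edge of `PSG_r` between vertices of the class that is not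
an edge of the shift cycle itself) equals Euler's totient `φ(r)`. -/
theorem stmt9 (r : ℕ) (hr : 2 ≤ r) :
    {C : Set (Equiv.Perm (Fin r)) |
      (∃ a, C = shiftClass r a) ∧
      ∃ u ∈ C, ∃ v ∈ C, PSGAdj r u v ∧ v ≠ forwardShift r u}.ncard =
    Nat.totient r := by
  obtain ⟨n, rfl⟩ : ∃ n, r = n + 2 := ⟨r - 2, by omega⟩
  rw [setOf_shiftClass_with_chord_eq_range, Set.ncard_range_of_injective
    shiftClass_unitPerm_injective, card_units_fin]
end

section
/- For r ≥ 2, τ(PSG_r) ≥ r!/r + φ(r), where φ is Euler's totient function; equivalently, a(PSG_r) ≤ r! − r!/r − φ(r). -/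
/-- If every vertex of a nonempty finite set `A` has an out-neighbour in `A`, then `A` contains
a cycle. -/
theorem exists_cycle_of_forall_exists_adj {V : Type*} [Finite V] {Adj : V → V → Prop} {A : Set V}
    (hne : A.Nonempty) (hstep : ∀ v ∈ A, ∃ u ∈ A, Adj v u) :
    ∃ (t : ℕ) (ht : 0 < t) (w : Fin t → V), Function.Injective w ∧ (∀ i, w i ∈ A) ∧
      ∀ i : Fin t, Adj (w i) (w ⟨(i.1 + 1) % t, Nat.mod_lt _ ht⟩) := by
  obtain ⟨x, hx⟩ := hne
  choose! f hfA hf using hstep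
  have hmem : ∀ n, f^[n] x ∈ A := fun n ↦ by
    induction n with
    | zero => exact hx
    | succ n ih => rw [Function.iterate_succ_apply']; exact hfA _ ih
  obtain ⟨m, n, hmn, heq⟩ : ∃ m n, m < n ∧ f^[m] x = f^[n] x := by
    obtain ⟨m, n, hne, heq⟩ := Finite.exists_ne_map_eq_of_infinite fun n ↦ f^[n] x
    rcases lt_or_gt_of_ne hne with h | h
    exacts [⟨m, n, h, heq⟩, ⟨n, m, h, heq.symm⟩]
  set y := f^[m] x with hy
  have hyA : ∀ k, f^[k] y ∈ A := fun k ↦ by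
    rw [hy, ← Function.iterate_add_apply]; exact hmem _
  have hper : Function.IsPeriodicPt f (n - m) y := by
    rw [Function.IsPeriodicPt, Function.IsFixedPt, hy, ← Function.iterate_add_apply,
      Nat.sub_add_cancel hmn.le]
    exact heq.symm
  refine ⟨Function.minimalPeriod f y, hper.minimalPeriod_pos (by omega), fun i ↦ f^[i.1] y,
    fun i j hij ↦ Fin.ext (Function.iterate_injOn_Iio_minimalPeriod i.2 j.2 hij),
    fun i ↦ hyA _, fun i ↦ ?_⟩
  simp only [Function.iterate_mod_minimalPeriod_eq, Function.iterate_succ_apply']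
  exact hf _ (hyA _)

/-- A disjoint family of nonempty vertex sets, each of minimum out-degree at least one, bounds
the cycle transversal number from below. -/
theorem card_le_cycleTransMin {V ι : Type*} [Fintype V] [Fintype ι] {Adj : V → V → Prop}
    (A : ι → Set V) (hne : ∀ i, (A i).Nonempty)
    (hstep : ∀ i, ∀ v ∈ A i, ∃ u ∈ A i, Adj v u)
    (hdisj : ∀ i j v, v ∈ A i → v ∈ A j → i = j) :
    Fintype.card ι ≤ cycleTransMin Adj := by
  refine le_csInf ⟨_, Finset.univ, rfl, fun t ht _ _ _ ↦ ⟨⟨0, ht⟩, Finset.mem_univ _⟩⟩ ?_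
  rintro _ ⟨S, rfl, hS⟩
  have hit : ∀ i, ∃ v ∈ S, v ∈ A i := fun i ↦ by
    obtain ⟨t, ht, w, hinj, hwA, hw⟩ := exists_cycle_of_forall_exists_adj (hne i) (hstep i)
    obtain ⟨j, hj⟩ := hS t ht w hinj hw
    exact ⟨_, hj, hwA j⟩
  choose s hsS hsA using hit
  rw [← Finset.card_univ]
  exact Finset.card_le_card_of_injOn s (fun i _ ↦ hsS i)
    fun i _ j _ hij ↦ hdisj i j _ (hsA i) (hij ▸ hsA j)

open Fin.CommRing

/-- If the first `r - 1` entries of `b` are obtained from the last `r - 1` entries of `a` by a map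
which is strictly monotone away from the first entry of `a`, then there is an edge from `a` to
`b`. -/
theorem psgAdj_of_strictMonoOn {n : ℕ} {a b : Equiv.Perm (Fin (n + 2))}
    (f : Fin (n + 2) → Fin (n + 2)) (hf : StrictMonoOn f {x | x ≠ a 0})
    (hb : ∀ i, b i = f (a (i + 1))) : PSGAdj (n + 2) a b := by
  intro i j hi hj
  have key : ∀ k (hk : k + 1 < n + 2),
      b ⟨k, Nat.lt_of_succ_lt hk⟩ = f (a ⟨k + 1, hk⟩) ∧ a ⟨k + 1, hk⟩ ≠ a 0 := by
    intro k hk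
    refine ⟨?_, fun h ↦ ?_⟩
    · rw [hb]
      congr 2
      ext
      simp [Fin.val_add, Nat.mod_eq_of_lt hk]
    · simpa [Fin.ext_iff] using a.injective h
  rw [(key i hi).1, (key j hj).1]
  exact (hf.lt_iff_lt (key i hi).2 (key j hj).2).symm

/-- `v` is an arithmetic progression modulo `r` with common difference `d`. -/
def IsCyclicAP {n : ℕ} (d : (Fin (n + 2))ˣ) (v : Equiv.Perm (Fin (n + 2))) : Prop :=
  ∀ i, v i = v 0 + i * d

/-- The starting points of the progressions with difference `d` that lie on the second of the two
cycles into which the rotation class of these progressions is split; they are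
`d - 1, 2 * d - 1, …, 0`. -/
def IsSecondStart {n : ℕ} (d : (Fin (n + 2))ˣ) (s : Fin (n + 2)) : Prop :=
  ↑d⁻¹ * (s + 1) ≠ 0 ∧ ↑d⁻¹ * (s + 1) ≤ (↑d⁻¹ : Fin (n + 2))

theorem IsCyclicAP.unique {n : ℕ} {d e : (Fin (n + 2))ˣ} {v : Equiv.Perm (Fin (n + 2))}
    (hd : IsCyclicAP d v) (he : IsCyclicAP e v) : d = e := by
  have := (hd 1).symm.trans (he 1)
  ext1
  simpa using this

/-- The vertex sets of the disjoint cycles: one for each rotation class, and an additional one for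
each class of arithmetic progressions. -/
def cycleFamily (n : ℕ) :
    {σ : Equiv.Perm (Fin (n + 2)) // σ 0 = 0} ⊕ (Fin (n + 2))ˣ → Set (Equiv.Perm (Fin (n + 2)))
  | .inl σ => {v | (∃ c, ∀ i, v (i + c) = σ.1 i) ∧ ∀ d, IsCyclicAP d v → ¬ IsSecondStart d (v 0)}
  | .inr d => {v | IsCyclicAP d v ∧ IsSecondStart d (v 0)}

theorem cycleFamily_disjoint {n : ℕ} (i j) (v : Equiv.Perm (Fin (n + 2)))
    (hi : v ∈ cycleFamily n i) (hj : v ∈ cycleFamily n j) : i = j := by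
  rcases i with σ | d <;> rcases j with τ | e
  · obtain ⟨⟨c, hc⟩, -⟩ := hi
    obtain ⟨⟨c', hc'⟩, -⟩ := hj
    have h : c = c' := by
      have h₁ := hc 0
      have h₂ := hc' 0
      rw [zero_add, σ.2] at h₁
      rw [zero_add, τ.2] at h₂
      exact v.injective (h₁.trans h₂.symm)
    subst h
    congr 1
    ext1
    ext1 k
    rw [← hc, ← hc']
  · exact absurd hj.2 (hi.2 e hj.1)
  · exact absurd hi.2 (hj.2 d hi.1)
  · rw [hi.1.unique hj.1]

theorem cycleFamily_nonempty {n : ℕ} (i) : (cycleFamily n i).Nonempty := by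
  rcases i with ⟨σ, hσ⟩ | d
  · by_cases h : ∃ d, IsCyclicAP d σ
    · obtain ⟨d, hd⟩ := h
      refine ⟨σ.trans (Equiv.addRight (-1)), ⟨↑d⁻¹, fun i ↦ ?_⟩, fun e _ hs ↦ hs.1 ?_⟩
      · have h₁ := hd (i + ↑d⁻¹)
        have h₂ := hd i
        simp only [hσ, zero_add] at h₁ h₂
        simp [h₁, h₂, add_mul]
      · simp [hσ]
    · push Not at h
      exact ⟨σ, ⟨0, fun i ↦ by simp⟩, fun d hd ↦ absurd hd (h d)⟩
  · refine ⟨d.mulRight, fun i ↦ by simp, ?_, ?_⟩ <;> simp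

theorem psgAdj_rotate {n : ℕ} (a : Equiv.Perm (Fin (n + 2))) :
    PSGAdj (n + 2) a ((Equiv.addRight 1).trans a) :=
  psgAdj_of_strictMonoOn id (strictMono_id.strictMonoOn _) fun _ ↦ rfl

theorem psgAdj_rotate_add_one {n : ℕ} {a : Equiv.Perm (Fin (n + 2))} (ha : a 0 = -1) :
    PSGAdj (n + 2) a (((Equiv.addRight 1).trans a).trans (Equiv.addRight 1)) := by
  refine psgAdj_of_strictMonoOn (· + 1) (fun x hx y hy hxy ↦ ?_) fun _ ↦ rfl
  have hlast : (-1 : Fin (n + 2)) = Fin.last (n + 1) :=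
    neg_eq_of_add_eq_zero_left (Fin.last_add_one _)
  simp only [ha, Set.mem_ofPred_eq, hlast] at hx hy
  simp only [Fin.lt_def] at hxy ⊢
  rw [Fin.val_add_one, Fin.val_add_one, if_neg hx, if_neg hy]
  omega

theorem psgAdj_rotate_sub_one {n : ℕ} {a : Equiv.Perm (Fin (n + 2))} (ha : a 0 = 0) :
    PSGAdj (n + 2) a (((Equiv.addRight 1).trans a).trans (Equiv.addRight (-1))) := by
  refine psgAdj_of_strictMonoOn (· + -1) (fun x hx y hy hxy ↦ ?_) fun _ ↦ rfl
  simp only [ha, Set.mem_ofPred_eq] at hx hy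
  simp only [← sub_eq_add_neg, Fin.lt_def] at hxy ⊢
  rw [Fin.val_sub_one_of_ne_zero hx, Fin.val_sub_one_of_ne_zero hy]
  simp only [ne_eq, Fin.ext_iff, Fin.val_zero] at hx hy
  omega

theorem IsCyclicAP.rotate {n : ℕ} {d : (Fin (n + 2))ˣ} {a : Equiv.Perm (Fin (n + 2))}
    (h : IsCyclicAP d a) (c : Fin (n + 2)) :
    IsCyclicAP d (((Equiv.addRight 1).trans a).trans (Equiv.addRight c)) := fun i ↦ by
  simp only [Equiv.trans_apply, Equiv.coe_addRight, zero_add]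
  rw [h (i + 1), h 1]
  ring

theorem IsCyclicAP.of_rotate {n : ℕ} {d : (Fin (n + 2))ˣ} {a : Equiv.Perm (Fin (n + 2))}
    (h : IsCyclicAP d ((Equiv.addRight 1).trans a)) : IsCyclicAP d a := fun i ↦ by
  have h₁ := h (i - 1)
  have h₂ := h (-1)
  simp only [Equiv.trans_apply, Equiv.coe_addRight, zero_add, sub_add_cancel,
    neg_add_cancel] at h₁ h₂
  rw [h₁, h₂]
  ring

theorem isSecondStart_add {n : ℕ} {d : (Fin (n + 2))ˣ} {s : Fin (n + 2)} (h0 : s ≠ 0)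
    (h1 : s ≠ -1) : IsSecondStart d (s + d) ↔ IsSecondStart d s := by
  have e : (↑d⁻¹ : Fin (n + 2)) * (s + d + 1) = ↑d⁻¹ * (s + 1) + 1 := by
    rw [add_right_comm, mul_add, Units.inv_mul]
  have hu0 : (↑d⁻¹ : Fin (n + 2)) * (s + 1) ≠ 0 := by
    rw [Ne, Units.mul_right_eq_zero]
    exact fun h ↦ h1 (eq_neg_of_add_eq_zero_left h)
  have hud : (↑d⁻¹ : Fin (n + 2)) * (s + 1) ≠ ↑d⁻¹ := fun h ↦ h0 <| by
    have h' := congrArg ((d : Fin (n + 2)) * ·) h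
    simpa using h'
  unfold IsSecondStart
  rw [e]
  generalize (↑d⁻¹ : Fin (n + 2)) * (s + 1) = u at *
  generalize (↑d⁻¹ : Fin (n + 2)) = w at *
  have hv := Fin.val_add_one u
  generalize u + 1 = x at *
  simp only [ne_eq, Fin.ext_iff, Fin.le_def, Fin.val_zero, Fin.val_last] at *
  split_ifs at hv <;> omega

theorem not_isSecondStart_self {n : ℕ} (d : (Fin (n + 2))ˣ) :
    ¬ IsSecondStart d (d : Fin (n + 2)) := by
  unfold IsSecondStart
  rw [mul_add, Units.inv_mul, mul_one, add_comm (1 : Fin (n + 2))]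
  generalize (↑d⁻¹ : Fin (n + 2)) = w
  have hv := Fin.val_add_one w
  generalize w + 1 = x at *
  simp only [ne_eq, Fin.ext_iff, Fin.le_def, Fin.val_zero, Fin.val_last] at *
  split_ifs at hv <;> omega

theorem cycleFamily_step {n : ℕ} (i) (v : Equiv.Perm (Fin (n + 2))) (hv : v ∈ cycleFamily n i) :
    ∃ u ∈ cycleFamily n i, PSGAdj (n + 2) v u := by
  rcases i with ⟨σ, hσ⟩ | d
  · obtain ⟨⟨c, hc⟩, hns⟩ := hv
    by_cases h : (∃ d, IsCyclicAP d v) ∧ v 0 = -1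
    · obtain ⟨⟨d, hd⟩, h0⟩ := h
      refine ⟨_, ⟨⟨-1, fun i ↦ ?_⟩, fun e he hs ↦ ?_⟩, psgAdj_rotate_add_one h0⟩
      · have h₁ := hd (i + c)
        have h₂ := hd (0 + c)
        have h₃ := hd i
        rw [hc] at h₁ h₂
        rw [hσ] at h₂
        simp only [Equiv.trans_apply, Equiv.coe_addRight, neg_add_cancel_right]
        rw [h₁, h₃, h0]
        rw [h0] at h₂
        linear_combination h₂
      · obtain rfl := (hd.rotate 1).unique he
        have h₁ := hd 1
        rw [h0, one_mul] at h₁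
        exact not_isSecondStart_self d (by simpa [h₁] using hs)
    · refine ⟨_, ⟨⟨c - 1, fun i ↦ ?_⟩, fun d hd hs ↦ ?_⟩, psgAdj_rotate v⟩
      · rw [← hc]
        simp [add_assoc]
      · have hd' := hd.of_rotate
        have h1 : v 0 ≠ -1 := fun h' ↦ h ⟨⟨d, hd'⟩, h'⟩
        have hn := hns d hd'
        have h0 : v 0 ≠ 0 := fun h' ↦ hn (by rw [h', IsSecondStart]; simp)
        refine hn ((isSecondStart_add h0 h1).1 ?_)
        have h₁ := hd' 1
        rw [one_mul] at h₁
        simpa [h₁] using hs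
  · obtain ⟨hd, hs⟩ := hv
    have h₁ := hd 1
    rw [one_mul] at h₁
    by_cases h0 : v 0 = 0
    · refine ⟨_, ⟨hd.rotate (-1), ?_⟩, psgAdj_rotate_sub_one h0⟩
      simp only [Equiv.trans_apply, Equiv.coe_addRight, zero_add, h₁, h0, IsSecondStart,
        neg_add_cancel_right, Units.inv_mul]
      exact ⟨one_ne_zero, Fin.one_le_of_ne_zero (Units.ne_zero _)⟩
    · have h1 : v 0 ≠ -1 := fun h' ↦ hs.1 (by simp [h'])
      refine ⟨_, ⟨fun i ↦ by simpa using hd.rotate 0 i, ?_⟩, psgAdj_rotate v⟩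
      simpa [h₁] using (isSecondStart_add h0 h1).2 hs

theorem factorial_le_card_perm_fixing_zero (n : ℕ) :
    n.factorial ≤ Fintype.card {σ : Equiv.Perm (Fin (n + 1)) // σ 0 = 0} := by
  have h : Fintype.card (Equiv.Perm (Fin n)) = n.factorial := by simp [Fintype.card_perm]
  rw [← h]
  refine Fintype.card_le_of_injective
    (fun e ↦ ⟨Equiv.Perm.decomposeFin.symm (0, e), by simp⟩) fun e e' h ↦ ?_
  simpa using h

/-- Theorem: for `r ≥ 2`, `τ(PSG_r) ≥ r!/r + φ(r)`. -/
theorem stmt10 (r : ℕ) (hr : 2 ≤ r) :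
    r.factorial / r + Nat.totient r ≤ cycleTransMin (PSGAdj r) := by
  obtain ⟨n, rfl⟩ := Nat.exists_eq_add_of_le' hr
  have hu : Fintype.card (Fin (n + 2))ˣ = Nat.totient (n + 2) := ZMod.card_units_eq_totient (n + 2)
  have h := card_le_cycleTransMin (cycleFamily n) cycleFamily_nonempty cycleFamily_step
    cycleFamily_disjoint
  rw [Fintype.card_sum, hu] at h
  rw [Nat.factorial_succ, Nat.mul_div_cancel_left _ (Nat.succ_pos _)]
  exact (Nat.add_le_add_right (factorial_le_card_perm_fixing_zero _) _).trans h
end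

section
/- Let r ≥ 2 and let G be an n-vertex r-digraph with n ≥ r−1. If G contains m copies of the directed tight cycle C^(r)_r, then G contains a directed tight path on at least m/n_(r−1) + (r−1) vertices. -/
open Finset in
/-- A nonempty rotation-closed family `W` of tuples with at least `c` tuples (up to rotation) per
element of its shadow has a nonempty rotation-closed subfamily of minimum codegree at least `c`.
Here `c = m / N`. -/
lemma exists_rotation_closed_subfamily {α : Type*} [DecidableEq α] {q N m : ℕ}
    (W : Finset (Fin (q + 1) → α)) (hne : W.Nonempty)
    (hrot : ∀ w ∈ W, ∀ k, (fun i => w (k + i)) ∈ W)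
    (hcard : (q + 1) * m * #(W.image Fin.init) ≤ N * #W) :
    ∃ W' ⊆ W, W'.Nonempty ∧ (∀ w ∈ W', ∀ k, (fun i => w (k + i)) ∈ W') ∧
      ∀ w ∈ W', m ≤ N * #{u ∈ W' | (Fin.init u : Fin q → α) = Fin.init w} := by
  induction W using Finset.strongInduction with
  | H W ih =>
    by_cases hdeg : ∀ w ∈ W, m ≤ N * #{u ∈ W | (Fin.init u : Fin q → α) = Fin.init w}
    · exact ⟨W, Subset.rfl, hne, hrot, hdeg⟩
    push Not at hdeg
    obtain ⟨w, hw, hlt⟩ := hdeg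
    set D := {u ∈ W | (Fin.init u : Fin q → α) = Fin.init w} with hD
    let V := {u ∈ W | ∀ k, (Fin.init (fun i => u (k + i)) : Fin q → α) ≠ Fin.init w}
    have hVW : V ⊆ W := filter_subset _ _
    have hwV : w ∉ V := by
      intro h
      have := (mem_filter.1 h).2 0
      simp at this
    have hss : V ⊂ W := (ssubset_iff_of_subset hVW).2 ⟨w, hw, hwV⟩
    have hVrot : ∀ u ∈ V, ∀ k, (fun i => u (k + i)) ∈ V := by
      intro u hu k
      obtain ⟨huW, huk⟩ := mem_filter.1 hu
      refine mem_filter.2 ⟨hrot u huW k, fun l => ?_⟩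
      have := huk (k + l)
      simpa only [add_assoc] using this
    have hcov : W \ V ⊆ image (fun p : Fin (q + 1) × (Fin (q + 1) → α) => fun i => p.2 (i - p.1))
        (univ ×ˢ D) := by
      intro u hu
      obtain ⟨huW, huV⟩ := mem_sdiff.1 hu
      have : ∃ k, (Fin.init (fun i => u (k + i)) : Fin q → α) = Fin.init w := by
        by_contra! h
        exact huV (mem_filter.2 ⟨huW, h⟩)
      obtain ⟨k, hk⟩ := this
      refine mem_image.2 ⟨(k, fun i => u (k + i)), ?_, ?_⟩
      · exact mem_product.2 ⟨mem_univ _, mem_filter.2 ⟨hrot u huW k, hk⟩⟩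
      · funext i
        simp
    have hremoved : #W ≤ #V + (q + 1) * #D := by
      have h1 := (card_le_card hcov).trans card_image_le
      rw [card_product, card_univ, Fintype.card_fin] at h1
      have h2 := card_sdiff_add_card_eq_card hVW
      omega
    have hshadow : #(V.image (Fin.init : _ → Fin q → α)) + 1 ≤ #(W.image Fin.init) := by
      refine card_lt_card ((ssubset_iff_of_subset (image_subset_image hVW)).2
        ⟨Fin.init w, mem_image_of_mem _ hw, fun h => ?_⟩)
      obtain ⟨u, hu, huw⟩ := mem_image.1 h
      have := (mem_filter.1 hu).2 0
      simp [huw] at this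
    have hlt' : (q + 1) * m * #(V.image (Fin.init : _ → Fin q → α)) < N * #V := by
      have h1 := Nat.mul_le_mul_left ((q + 1) * m) hshadow
      have h2 := Nat.mul_le_mul_left N hremoved
      have h3 := Nat.mul_lt_mul_of_pos_left hlt q.succ_pos
      simp only [Nat.succ_eq_add_one] at h3
      nlinarith
    have hVne : V.Nonempty := by
      rw [nonempty_iff_ne_empty]
      intro h
      simp [h] at hlt'
    obtain ⟨W', hW', h⟩ := ih V hss hVne hVrot hlt'.le
    exact ⟨W', hW'.trans hVW, h⟩

open Finset in
/-- In a nonempty rotation-closed family of injective tuples in which every shadow element has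
more than `s` extensions for all `s < d`, one greedily finds a tight path with `d` edges. -/
lemma exists_tight_path_of_min_codegree {α : Type*} [DecidableEq α] {q d : ℕ}
    (W : Finset (Fin (q + 1) → α)) (hne : W.Nonempty)
    (hinj : ∀ w ∈ W, Function.Injective w)
    (hrot : ∀ w ∈ W, ∀ k, (fun i => w (k + i)) ∈ W)
    (hdeg : ∀ w ∈ W, d ≤ #{u ∈ W | (Fin.init u : Fin q → α) = Fin.init w}) :
    ∃ v : ℕ → α, Set.InjOn v (Set.Iio (d + q)) ∧
      ∀ j < d, (fun i : Fin (q + 1) => v (j + i)) ∈ W := by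
  suffices h : ∀ s ≤ d, ∃ v : ℕ → α, Set.InjOn v (Set.Iio (s + q)) ∧
      (∀ j < s, (fun i : Fin (q + 1) => v (j + i)) ∈ W) ∧
      ∃ w ∈ W, ∀ i : Fin q, w i.castSucc = v (s + i) by
    obtain ⟨v, hv, hvW, -⟩ := h d le_rfl
    exact ⟨v, hv, hvW⟩
  intro s
  induction s with
  | zero =>
    intro _
    obtain ⟨w, hw⟩ := hne
    refine ⟨fun j => if h : j < q + 1 then w ⟨j, h⟩ else w 0, ?_, by simp, w, hw, ?_⟩
    · intro a ha b hb hab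
      simp only [Set.mem_Iio, zero_add] at ha hb
      have ha' : a < q + 1 := by omega
      have hb' : b < q + 1 := by omega
      simp only [ha', hb', dif_pos] at hab
      simpa using hinj w hw hab
    · intro i
      have : (i : ℕ) < q + 1 := by omega
      simp only [zero_add, this, dif_pos]
      rfl
  | succ s ih =>
    intro hs
    obtain ⟨v, hv, hvW, w, hw, hwv⟩ := ih (by omega)
    have hlast : Set.InjOn (fun u : Fin (q + 1) → α => u (Fin.last q))
        ({u ∈ W | (Fin.init u : Fin q → α) = Fin.init w} : Finset _) := by
      intro a ha b hb hab
      have ha := (mem_filter.1 ha).2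
      have hb := (mem_filter.1 hb).2
      rw [← Fin.snoc_init_self a, ← Fin.snoc_init_self b, ha, hb]
      simp only at hab
      rw [hab]
    have hcard : #((range s).image v) <
        #(({u ∈ W | (Fin.init u : Fin q → α) = Fin.init w}).image (fun u => u (Fin.last q))) := by
      rw [card_image_of_injOn hlast]
      have h1 := card_image_le (s := range s) (f := v)
      rw [card_range] at h1
      have h2 := hdeg w hw
      omega
    obtain ⟨x, hx, hxv⟩ := exists_mem_notMem_of_card_lt_card hcard
    obtain ⟨u, hu, rfl⟩ := mem_image.1 hx
    obtain ⟨huW, huw⟩ := mem_filter.1 hu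
    have huv : ∀ i : Fin q, u i.castSucc = v (s + i) := fun i => by
      rw [← hwv i]
      exact congrFun huw i
    have hnew : ∀ j < s + q, v j ≠ u (Fin.last q) := by
      intro j hj h
      by_cases hjs : j < s
      · exact hxv (mem_image.2 ⟨j, mem_range.2 hjs, h⟩)
      · have h1 := huv ⟨j - s, by omega⟩
        simp only [Nat.add_sub_cancel' (not_lt.1 hjs)] at h1
        have h2 := congrArg Fin.val (hinj u huW (h1.trans h))
        simp only [Fin.val_castSucc, Fin.val_last] at h2
        omega
    let v' := Function.update v (s + q) (u (Fin.last q))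
    have hv'old : ∀ j, j ≠ s + q → v' j = v j := fun j hj => Function.update_of_ne hj _ _
    have hv'new : v' (s + q) = u (Fin.last q) := Function.update_self _ _ _
    have hwin : ∀ i : Fin (q + 1), v' (s + i) = u i := by
      intro i
      induction i using Fin.lastCases with
      | last => exact hv'new
      | cast i =>
        rw [huv i, hv'old _ (by simp only [Fin.val_castSucc]; omega), Fin.val_castSucc]
    refine ⟨v', ?_, ?_, _, hrot u huW 1, ?_⟩
    · intro a ha b hb hab
      simp only [Set.mem_Iio] at ha hb
      by_cases ha' : a = s + q <;> by_cases hb' : b = s + q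
      · omega
      · rw [ha', hv'new, hv'old b hb'] at hab
        exact absurd hab.symm (hnew b (by omega))
      · rw [hb', hv'new, hv'old a ha'] at hab
        exact absurd hab (hnew a (by omega))
      · rw [hv'old a ha', hv'old b hb'] at hab
        exact hv (Set.mem_Iio.2 (by omega)) (Set.mem_Iio.2 (by omega)) hab
    · intro j hj
      rcases Nat.lt_succ_iff_lt_or_eq.1 hj with hj | rfl
      · convert hvW j hj using 2 with i
        exact hv'old _ (by omega)
      · simpa only [hwin] using huW
    · intro i
      have h1 := hwin i.succ
      rw [Fin.val_succ] at h1
      rw [add_comm, Fin.coeSucc_eq_succ, ← h1]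
      congr 1
      omega

/-- The shadow of a family of injective tuples consists of injective tuples. -/
lemma card_image_init_le {n q : ℕ} (W : Finset (Fin (q + 1) → Fin n))
    (hinj : ∀ w ∈ W, Function.Injective w) :
    (W.image (Fin.init : _ → Fin q → Fin n)).card ≤ n.descFactorial q := by
  have hsub : W.image (Fin.init : _ → Fin q → Fin n) ⊆
      (Finset.univ : Finset (Fin q ↪ Fin n)).image DFunLike.coe := by
    intro t ht
    obtain ⟨w, hw, rfl⟩ := Finset.mem_image.1 ht
    let f : Fin q ↪ Fin n := ⟨Fin.init w, (hinj w hw).comp (Fin.castSucc_injective q)⟩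
    exact Finset.mem_image.2 ⟨f, Finset.mem_univ _, rfl⟩
  refine (Finset.card_le_card hsub).trans (Finset.card_image_le.trans ?_)
  rw [Finset.card_univ, Fintype.card_embedding_eq, Fintype.card_fin, Fintype.card_fin]

/-- Lemma: if an `n`-vertex `r`-digraph (`n ≥ r−1`, `r ≥ 2`) contains `m`
copies of the directed tight cycle `C^(r)_r` (each copy corresponds to exactly
`r` injective `r`-tuples, one per rotation, all of whose rotations are edges),
then it contains a tight path on at least `m/n_(r−1) + (r−1)` vertices. -/
theorem stmt11 (r n m : ℕ) (hr : 2 ≤ r) (hn : r - 1 ≤ n)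
    (E : Set (Fin r → Fin n)) (hE : ∀ e ∈ E, Function.Injective e)
    (hm : {w : Fin r → Fin n | Function.Injective w ∧
        ∀ k : Fin r, (fun i : Fin r => w (k + i)) ∈ E}.ncard = r * m) :
    ∃ s : ℕ, (m : ℚ) / (n.descFactorial (r - 1) : ℚ) + ((r : ℚ) - 1) ≤ (s : ℚ) ∧
      HasTightPath r E s := by
  classical
  obtain ⟨q, rfl⟩ : ∃ q, r = q + 1 := ⟨r - 1, by omega⟩
  simp only [Nat.add_sub_cancel] at hn ⊢
  have hN : 0 < n.descFactorial q := Nat.descFactorial_pos.2 hn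
  generalize hNdef : n.descFactorial q = N at hN ⊢
  rcases Nat.eq_zero_or_pos m with rfl | hmpos
  · refine ⟨q, by simp, Fin.castLE hn, Fin.castLE_injective hn, fun j h => by omega⟩
  set S := {w : Fin (q + 1) → Fin n | Function.Injective w ∧
    ∀ k : Fin (q + 1), (fun i : Fin (q + 1) => w (k + i)) ∈ E} with hS
  let W := S.toFinset
  have hWcard : W.card = (q + 1) * m := by rw [← hm, Set.ncard_eq_toFinset_card']
  have hWinj : ∀ w ∈ W, Function.Injective w := fun w hw => (Set.mem_toFinset.1 hw).1
  have hrot : ∀ w ∈ W, ∀ k, (fun i => w (k + i)) ∈ W := by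
    intro w hw k
    obtain ⟨h1, h2⟩ := Set.mem_toFinset.1 hw
    refine Set.mem_toFinset.2 ⟨h1.comp (add_right_injective k), fun l => ?_⟩
    simpa only [add_assoc] using h2 (k + l)
  have hne : W.Nonempty := by
    rw [← Finset.card_pos, hWcard]
    positivity
  have hshadow : (W.image (Fin.init : _ → Fin q → Fin n)).card ≤ N :=
    hNdef ▸ card_image_init_le W hWinj
  obtain ⟨W', hW'W, hW'ne, hW'rot, hW'deg⟩ :=
    exists_rotation_closed_subfamily (N := N) (m := m) W hne hrot (by
      rw [hWcard, mul_comm N]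
      exact Nat.mul_le_mul_left _ hshadow)
  obtain ⟨v, hv, hvW⟩ := exists_tight_path_of_min_codegree (d := ⌈(m : ℚ) / N⌉₊) W' hW'ne
    (fun w hw => hWinj w (hW'W hw)) hW'rot (fun w hw => by
      rw [Nat.ceil_le, div_le_iff₀ (by exact_mod_cast hN), mul_comm]
      exact_mod_cast hW'deg w hw)
  refine ⟨⌈(m : ℚ) / N⌉₊ + q, ?_, fun i => v i, ?_, ?_⟩
  · push_cast
    linarith [Nat.le_ceil ((m : ℚ) / N)]
  · intro a b hab
    exact Fin.ext (hv (Set.mem_Iio.2 a.isLt) (Set.mem_Iio.2 b.isLt) hab)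
  · intro j h
    have h1 := (Set.mem_toFinset.1 (hW'W (hvW j (by omega)))).2 0
    simpa using h1
end

section
/- Let r ≥ 2 and let k = r! − (r−1)! + 1 (equivalently, k = (1 − 1/r + 1/r!)·r!). Then every n-vertex (r,k)-tournament with n ≥ r contains a directed tight path on at least n/r! vertices. -/
section TightPaths

open Finset

/-- A finite `r`-digraph closed under all cyclic rotations of its edges. -/
def RotationClosed {m : ℕ} {α : Type*} (F : Finset (Fin (m + 1) → α)) : Prop :=
  ∀ e ∈ F, ∀ c : Fin (m + 1), (fun i => e (i + c)) ∈ F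

/-- All rotations of members of `N`. -/
def rotations {m : ℕ} {α : Type*} [DecidableEq α] (N : Finset (Fin (m + 1) → α)) :
    Finset (Fin (m + 1) → α) :=
  (univ ×ˢ N).image fun p i => p.2 (i + p.1)

lemma mem_rotations {m : ℕ} {α : Type*} [DecidableEq α] {N : Finset (Fin (m + 1) → α)} {e : Fin (m + 1) → α} :
    e ∈ rotations N ↔ ∃ c, ∃ f ∈ N, (fun i => f (i + c)) = e := by
  simp [rotations]

lemma card_rotations_le {m : ℕ} {α : Type*} [DecidableEq α] (N : Finset (Fin (m + 1) → α)) :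
    (rotations N).card ≤ (m + 1) * N.card := by
  refine card_image_le.trans ?_
  simp [card_product]

lemma subset_rotations {m : ℕ} {α : Type*} [DecidableEq α] (N : Finset (Fin (m + 1) → α)) :
    N ⊆ rotations N := fun e he => mem_rotations.2 ⟨0, e, he, by simp⟩

lemma RotationClosed.sdiff_rotations {m : ℕ} {α : Type*} [DecidableEq α] {F : Finset (Fin (m + 1) → α)}
    (hF : RotationClosed F) (N : Finset (Fin (m + 1) → α)) :
    RotationClosed (F \ rotations N) := by
  intro e he c
  rw [mem_sdiff] at he ⊢
  refine ⟨hF e he.1 c, fun h => he.2 ?_⟩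
  obtain ⟨b, f, hf, hfe⟩ := mem_rotations.1 h
  refine mem_rotations.2 ⟨b - c, f, hf, ?_⟩
  funext i
  have := congrFun hfe (i - c)
  simp only [sub_add_cancel] at this
  rw [← this]
  congr 1
  abel

/-- A dense rotation-closed digraph has a nonempty rotation-closed subdigraph in which every
`m`-tuple starting an edge starts more than `d` edges. -/
lemma RotationClosed.exists_subset_min_degree {m d : ℕ} {α : Type*} [DecidableEq α]
    {F : Finset (Fin (m + 1) → α)} (hF : RotationClosed F)
    (hd : (m + 1) * d * (F.image Fin.init).card < F.card) :
    ∃ G ⊆ F, RotationClosed G ∧ G.Nonempty ∧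
      ∀ e ∈ G, d < {f ∈ G | Fin.init f = Fin.init e}.card := by
  induction F using Finset.strongInduction with
  | H F ih =>
    by_cases h : ∀ e ∈ F, d < {f ∈ F | Fin.init f = Fin.init e}.card
    · exact ⟨F, Subset.rfl, hF, card_pos.1 (by omega), h⟩
    push Not at h
    obtain ⟨e, he, hle⟩ := h
    set N := {f ∈ F | Fin.init f = Fin.init e} with hN
    have heN : e ∈ N := by simp [hN, he]
    have heR : e ∈ rotations N := subset_rotations N heN
    have hss : F \ rotations N ⊂ F :=
      ⟨sdiff_subset, fun hsub => (mem_sdiff.1 (hsub he)).2 heR⟩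
    have himg : ((F \ rotations N).image Fin.init).card < (F.image Fin.init).card := by
      refine card_lt_card ⟨image_subset_image sdiff_subset, fun hsub => ?_⟩
      obtain ⟨f, hf, hfe⟩ := mem_image.1 (hsub (mem_image_of_mem Fin.init he))
      rw [mem_sdiff] at hf
      exact hf.2 (subset_rotations N (by simp [hN, hf.1, hfe]))
    have hcard : F.card ≤ (F \ rotations N).card + (m + 1) * d := by
      have h1 := card_le_card_sdiff_add_card (s := F) (t := rotations N)
      have h2 := card_rotations_le N
      have h3 := Nat.mul_le_mul_left (m + 1) hle
      omega
    obtain ⟨G, hGF, hG⟩ := ih _ hss (hF.sdiff_rotations N) (by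
      have := Nat.mul_le_mul_left ((m + 1) * d) (Nat.succ_le_of_lt himg)
      rw [Nat.mul_succ] at this
      omega)
    exact ⟨G, hGF.trans sdiff_subset, hG⟩

/-- In a rotation-closed digraph of minimum positive degree more than `d`, a tight path can be
extended greedily to `m + 1 + d` vertices. -/
lemma RotationClosed.exists_tight_path {m d : ℕ} {α : Type*} [DecidableEq α]
    {G : Finset (Fin (m + 1) → α)} (hG : RotationClosed G) (hne : G.Nonempty)
    (hinj : ∀ e ∈ G, Function.Injective e)
    (hdeg : ∀ e ∈ G, d < {f ∈ G | Fin.init f = Fin.init e}.card) :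
    ∀ t ≤ d, ∃ v : ℕ → α, Set.InjOn v (Set.Iio (m + 1 + t)) ∧
      ∀ j ≤ t, (fun i : Fin (m + 1) => v (j + i)) ∈ G := by
  intro t
  induction t with
  | zero =>
    intro _
    obtain ⟨e, he⟩ := hne
    refine ⟨fun a => e (Fin.ofNat (m + 1) a), fun a ha b hb hab => ?_, fun j hj => ?_⟩
    · have := congrArg Fin.val (hinj e he hab)
      simp only [Fin.val_ofNat] at this
      rwa [Nat.mod_eq_of_lt (by simpa using ha), Nat.mod_eq_of_lt (by simpa using hb)] at this
    · obtain rfl : j = 0 := by omega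
      simpa using he
  | succ t ih =>
    intro ht
    obtain ⟨v, hv, hE⟩ := ih (by omega)
    set e : Fin (m + 1) → α := fun i => v (t + (i + 1 : Fin (m + 1)))
    have he : e ∈ G := hG _ (hE t le_rfl) 1
    have hinit : ∀ i : Fin m, Fin.init e i = v (t + 1 + i) := fun i => by
      simp only [Fin.init, e, Fin.coeSucc_eq_succ, Fin.val_succ]
      congr 1
      omega
    have hlast : Set.InjOn (fun f : Fin (m + 1) → α => f (Fin.last m))
        ({f ∈ G | Fin.init f = Fin.init e} : Finset (Fin (m + 1) → α)) := by
      intro f hf g hg hfg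
      simp only [coe_filter, Set.mem_ofPred_eq] at hf hg hfg
      rw [← Fin.snoc_init_self f, ← Fin.snoc_init_self g, hf.2, hg.2, hfg]
    obtain ⟨w, hw, hwv⟩ : ∃ w ∈ ({f ∈ G | Fin.init f = Fin.init e}.image
        fun f => f (Fin.last m)), w ∉ (range (t + 1)).image v := by
      apply exists_mem_notMem_of_card_lt_card
      have h0 := card_image_of_injOn hlast
      have h1 := hdeg e he
      have h2 := card_image_le (s := range (t + 1)) (f := v)
      rw [card_range] at h2
      omega
    obtain ⟨f, hf, rfl⟩ := mem_image.1 hw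
    obtain ⟨hfG, hfe⟩ := mem_filter.1 hf
    have hfi : ∀ i : Fin m, f i.castSucc = v (t + 1 + i) := fun i => by
      rw [← hinit, ← hfe]; rfl
    have hnew : ∀ a < m + 1 + t, v a ≠ f (Fin.last m) := by
      intro a ha hav
      by_cases hat : a < t + 1
      · exact hwv (mem_image.2 ⟨a, by simpa using hat, hav⟩)
      · have h := hfi ⟨a - (t + 1), by omega⟩
        simp only [Nat.add_sub_cancel' (not_lt.1 hat), hav] at h
        have := congrArg Fin.val (hinj f hfG h)
        simp at this
        omega
    refine ⟨Function.update v (m + 1 + t) (f (Fin.last m)), ?_, ?_⟩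
    · intro a ha b hb hab
      simp only [Set.mem_Iio] at ha hb
      rcases eq_or_ne a (m + 1 + t) with rfl | ha' <;> rcases eq_or_ne b (m + 1 + t) with rfl | hb'
      · rfl
      · rw [Function.update_self, Function.update_of_ne hb'] at hab
        exact absurd hab.symm (hnew b (by omega))
      · rw [Function.update_self, Function.update_of_ne ha'] at hab
        exact absurd hab (hnew a (by omega))
      · rw [Function.update_of_ne ha', Function.update_of_ne hb'] at hab
        exact hv (by simp; omega) (by simp; omega) hab
    · intro j hj
      rcases Nat.lt_or_ge t j with htj | htj
      · obtain rfl : j = t + 1 := by omega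
        convert hfG using 1
        funext i
        refine Fin.lastCases ?_ (fun i => ?_) i
        · rw [Fin.val_last, show t + 1 + m = m + 1 + t by omega, Function.update_self]
        · rw [Fin.val_castSucc, Function.update_of_ne (by omega), hfi]
      · convert hE j htj using 1
        funext i
        rw [Function.update_of_ne (by omega)]

open Classical in
lemma card_injective_functions (m n : ℕ) :
    #{e : Fin m → Fin n | Function.Injective e} = n.descFactorial m := by
  rw [← Fintype.card_subtype, Fintype.card_congr (Equiv.subtypeInjectiveEquivEmbedding _ _),
    Fintype.card_embedding_eq, Fintype.card_fin, Fintype.card_fin]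

open Classical in
lemma IsRKTournament.card_edges {r k n : ℕ} {E : Set (Fin r → Fin n)}
    (hT : IsRKTournament r k n E) : #{e | e ∈ E} = n.choose r * k := by
  rw [card_eq_sum_card_fiberwise (f := fun e => univ.image e) (t := powersetCard r univ)]
  · rw [sum_congr rfl (g := fun _ => k), sum_const, card_powersetCard, card_univ, Fintype.card_fin,
      smul_eq_mul]
    intro S hS
    have hSr := (mem_powersetCard.1 hS).2
    rw [← hT.2 S hSr, ← Set.ncard_coe_finset]
    congr 1
    ext e
    simp only [coe_filter, mem_filter, mem_univ, true_and, Set.mem_ofPred_eq]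
    refine and_congr_right fun he => ⟨fun h i => h ▸ mem_image_of_mem e (mem_univ i), fun h => ?_⟩
    refine eq_of_subset_of_card_le (image_subset_iff.2 fun i _ => h i) ?_
    rw [card_image_of_injective _ (hT.1 e he), hSr, card_univ, Fintype.card_fin]
  · intro e he
    simp only [coe_filter, mem_univ, true_and, Set.mem_ofPred_eq] at he
    simp [card_image_of_injective _ (hT.1 e he)]

open Classical in
/-- Some `C(n, r) · r` of the edges have all their rotations among the edges. -/
lemma IsRKTournament.exists_rotationClosed {m n : ℕ} {E : Set (Fin (m + 1) → Fin n)}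
    (hT : IsRKTournament (m + 1) ((m + 1).factorial - m.factorial + 1) n E) :
    ∃ F : Finset (Fin (m + 1) → Fin n), RotationClosed F ∧ (∀ e ∈ F, e ∈ E) ∧
      n.choose (m + 1) * (m + 1) ≤ #F := by
  set I : Finset (Fin (m + 1) → Fin n) := {e | Function.Injective e} with hI
  set A : Finset (Fin (m + 1) → Fin n) := {e | e ∈ E} with hA
  have hAI : A ⊆ I := fun e he => by
    simp only [hI, hA, mem_filter, mem_univ, true_and] at he ⊢
    exact hT.1 e he
  have hIrot : RotationClosed I := fun e he c => by
    simp only [hI, mem_filter, mem_univ, true_and] at he ⊢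
    exact he.comp (add_left_injective c)
  refine ⟨I \ rotations (I \ A), hIrot.sdiff_rotations _, fun e he => ?_, ?_⟩
  · rw [mem_sdiff] at he
    by_contra hne
    exact he.2 (subset_rotations _ (mem_sdiff.2 ⟨he.1, by simpa [hA] using hne⟩))
  · have hIc : #I = n.choose (m + 1) * (m + 1).factorial := by
      rw [card_injective_functions, Nat.descFactorial_eq_factorial_mul_choose, mul_comm]
    have h1 := card_le_card_sdiff_add_card (s := I) (t := rotations (I \ A))
    have h2 := card_rotations_le (I \ A)
    have h3 := card_sdiff_add_card_eq_card hAI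
    rw [hIc, hT.card_edges] at h3
    have hpos := m.factorial_pos
    obtain ⟨a, ha⟩ : ∃ a, m.factorial = a + 1 := ⟨m.factorial - 1, by omega⟩
    have h4 : (m + 1).factorial = (m + 1) * (a + 1) := by rw [Nat.factorial_succ, ha]
    have hk : (m + 1).factorial - m.factorial + 1 = m * (a + 1) + 1 := by
      rw [h4, ha, Nat.add_mul, one_mul, Nat.add_sub_cancel]
    rw [hk, h4] at h3
    rw [hIc, h4] at h1
    have hN : #(I \ A) = n.choose (m + 1) * a := by linarith
    rw [hN] at h2
    linarith

end TightPaths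

/-- Theorem: with `k = r! − (r−1)! + 1`, every `n`-vertex `(r,k)`-tournament
(`n ≥ r ≥ 2`) contains a tight path on at least `n/r!` vertices. -/
theorem stmt12 (r n : ℕ) (hr : 2 ≤ r) (hn : r ≤ n)
    (E : Set (Fin r → Fin n))
    (hT : IsRKTournament r (r.factorial - (r - 1).factorial + 1) n E) :
    ∃ s : ℕ, (n : ℚ) / (r.factorial : ℚ) ≤ (s : ℚ) ∧ HasTightPath r E s := by
  classical
  obtain ⟨m, rfl⟩ : ∃ m, r = m + 1 := ⟨r - 1, by omega⟩
  obtain ⟨F, hF, hFE, hcard⟩ := IsRKTournament.exists_rotationClosed (by simpa using hT)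
  obtain ⟨d, hd⟩ : ∃ d, d = (n - (m + 1)) / (m + 1).factorial := ⟨_, rfl⟩
  have hfac := (m + 1).factorial_pos
  have hshadow : (F.image Fin.init).card ≤ n.descFactorial m := by
    rw [← card_injective_functions]
    refine Finset.card_le_card (Finset.image_subset_iff.2 fun e he => ?_)
    simp only [Finset.mem_filter, Finset.mem_univ, true_and]
    exact (hT.1 e (hFE e he)).comp (Fin.castSucc_injective m)
  have hdense : (m + 1) * d * (F.image Fin.init).card < F.card := by
    have hdm : d * (m + 1).factorial < n - m := by
      have := Nat.div_mul_le_self (n - (m + 1)) (m + 1).factorial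
      rw [← hd] at this
      omega
    refine lt_of_le_of_lt (Nat.mul_le_mul_left _ hshadow) (lt_of_lt_of_le ?_ hcard)
    have hch := Nat.descFactorial_eq_factorial_mul_choose n (m + 1)
    rw [Nat.descFactorial_succ] at hch
    have hD : 0 < n.descFactorial m := Nat.descFactorial_pos.2 (by omega)
    refine Nat.lt_of_mul_lt_mul_left (a := (m + 1).factorial) ?_
    calc (m + 1).factorial * ((m + 1) * d * n.descFactorial m)
        = (m + 1) * n.descFactorial m * (d * (m + 1).factorial) := by ring
      _ < (m + 1) * n.descFactorial m * (n - m) :=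
          Nat.mul_lt_mul_of_pos_left hdm (by positivity)
      _ = (m + 1) * ((n - m) * n.descFactorial m) := by ring
      _ = (m + 1).factorial * (n.choose (m + 1) * (m + 1)) := by rw [hch]; ring
  obtain ⟨G, hGF, hG, hne, hdeg⟩ := hF.exists_subset_min_degree hdense
  obtain ⟨v, hv, hvG⟩ := hG.exists_tight_path hne
    (fun e he => hT.1 e (hFE e (hGF he))) hdeg d le_rfl
  refine ⟨m + 1 + d, ?_, fun i => v i, fun a b hab => Fin.ext (hv a.2 b.2 hab),
    fun j hj => hFE _ (hGF (hvG j (by omega)))⟩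
  rw [div_le_iff₀ (by exact_mod_cast hfac)]
  norm_cast
  have h1 : n - (m + 1) < (d + 1) * (m + 1).factorial := by
    rw [mul_comm]
    exact hd ▸ Nat.lt_mul_div_succ _ hfac
  have h2 := Nat.self_le_factorial (m + 1)
  have h3 : 1 * (m + 1).factorial ≤ m * (m + 1).factorial := Nat.mul_le_mul_right _ (by omega)
  have h4 : (m + 1 + d) * (m + 1).factorial
      = (d + 1) * (m + 1).factorial + m * (m + 1).factorial := by ring
  omega
end
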